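/- arXiv:math/9803065 — 5 statements merged into one kernel-verified Lean document; each statement's English description precedes it below -/
import Mathlib

section
/- For every integer m ≥ 2, one has cos((m−1)φ/2) > 0 for all φ ∈ [π/(m+1), π/m], and the map F_m : [π/(m+1), π/m] → [0,1] is well defined, continuous, strictly increasing and bijective onto [0,1]. -/
open Real Set

/-- For an integer `m ≥ 2`, the function
`F_m(φ) = -cos((m+1)φ/2) / cos((m-1)φ/2)`. -/
noncomputable def Fm (m : ℕ) (φ : ℝ) : ℝ :=
  -Real.cos (((m : ℝ) + 1) * φ / 2) / Real.cos (((m : ℝ) - 1) * φ / 2)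

theorem mem_bounds_of_mem_Icc {m : ℕ} (hm : 2 ≤ m) {φ : ℝ}
    (h : φ ∈ Set.Icc (π / ((m : ℝ) + 1)) (π / (m : ℝ))) :
    0 < φ ∧ π ≤ ((m : ℝ) + 1) * φ ∧ (m : ℝ) * φ ≤ π := by
  have hm' : (2 : ℝ) ≤ m := by exact_mod_cast hm
  obtain ⟨h1, h2⟩ := h
  have h0 : 0 < π / ((m : ℝ) + 1) := by positivity
  rw [div_le_iff₀ (by linarith)] at h1
  rw [le_div_iff₀ (by linarith)] at h2
  exact ⟨by nlinarith [pi_pos], by linarith, by linarith⟩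

theorem cos_sub_one_mul_half_pos {m : ℕ} (hm : 2 ≤ m) {φ : ℝ}
    (h : φ ∈ Set.Icc (π / ((m : ℝ) + 1)) (π / (m : ℝ))) :
    0 < Real.cos (((m : ℝ) - 1) * φ / 2) := by
  have hm' : (2 : ℝ) ≤ m := by exact_mod_cast hm
  obtain ⟨h0, -, h2⟩ := mem_bounds_of_mem_Icc hm h
  have : 0 ≤ ((m : ℝ) - 1) * φ := mul_nonneg (by linarith) h0.le
  apply Real.cos_pos_of_mem_Ioo
  constructor <;> linarith [pi_pos]

theorem continuousOn_Fm {m : ℕ} (hm : 2 ≤ m) :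
    ContinuousOn (Fm m) (Set.Icc (π / ((m : ℝ) + 1)) (π / (m : ℝ))) := by
  unfold Fm
  exact ContinuousOn.div (by fun_prop) (by fun_prop)
    fun φ hφ => (cos_sub_one_mul_half_pos hm hφ).ne'

theorem strictMonoOn_Fm {m : ℕ} (hm : 2 ≤ m) :
    StrictMonoOn (Fm m) (Set.Icc (π / ((m : ℝ) + 1)) (π / (m : ℝ))) := by
  intro x hx y hy hxy
  have hm' : (2 : ℝ) ≤ m := by exact_mod_cast hm
  obtain ⟨hx0, hx1, hx2⟩ := mem_bounds_of_mem_Icc hm hx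
  obtain ⟨hy0, hy1, hy2⟩ := mem_bounds_of_mem_Icc hm hy
  have hmy : 2 * y ≤ m * y := by gcongr
  have hnum : Real.cos (((m : ℝ) + 1) * y / 2) < Real.cos (((m : ℝ) + 1) * x / 2) := by
    apply Real.cos_lt_cos_of_nonneg_of_le_pi
    · linarith [pi_pos]
    · linarith
    · gcongr
  have hden : Real.cos (((m : ℝ) - 1) * y / 2) ≤ Real.cos (((m : ℝ) - 1) * x / 2) := by
    have hx3 : 0 ≤ ((m : ℝ) - 1) * x := mul_nonneg (by linarith) hx0.le
    have hxy' : ((m : ℝ) - 1) * x ≤ ((m : ℝ) - 1) * y :=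
      mul_le_mul_of_nonneg_left hxy.le (by linarith)
    apply Real.cos_le_cos_of_nonneg_of_le_pi <;> linarith
  have hnonpos : Real.cos (((m : ℝ) + 1) * x / 2) ≤ 0 := by
    apply Real.cos_nonpos_of_pi_div_two_le_of_le <;> nlinarith
  exact div_lt_div₀ (neg_lt_neg hnum) hden (by linarith)
    (cos_sub_one_mul_half_pos hm hy)

theorem Fm_pi_div_add_one (m : ℕ) : Fm m (π / ((m : ℝ) + 1)) = 0 := by
  have : ((m : ℝ) + 1) * (π / ((m : ℝ) + 1)) = π := by field_simp
  simp [Fm, this]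

theorem Fm_pi_div {m : ℕ} (hm : 2 ≤ m) : Fm m (π / (m : ℝ)) = 1 := by
  have hm' : (2 : ℝ) ≤ m := by exact_mod_cast hm
  have hmem : π / (m : ℝ) ∈ Set.Icc (π / ((m : ℝ) + 1)) (π / (m : ℝ)) :=
    ⟨by gcongr; linarith, le_rfl⟩
  have : ((m : ℝ) + 1) * (π / m) / 2 = π - ((m : ℝ) - 1) * (π / m) / 2 := by
    field_simp
    ring
  rw [Fm, this, Real.cos_pi_sub, neg_neg,
    div_self (cos_sub_one_mul_half_pos hm hmem).ne']

/-- For every integer `m ≥ 2`, one has `cos((m−1)φ/2) > 0` for all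
`φ ∈ [π/(m+1), π/m]`, and `F_m : [π/(m+1), π/m] → [0,1]` is well defined,
continuous, strictly increasing and bijective onto `[0,1]`. -/
theorem stmt_0 (m : ℕ) (hm : 2 ≤ m) :
    (∀ φ ∈ Set.Icc (π / ((m : ℝ) + 1)) (π / (m : ℝ)),
      0 < Real.cos (((m : ℝ) - 1) * φ / 2)) ∧
    Set.MapsTo (Fm m) (Set.Icc (π / ((m : ℝ) + 1)) (π / (m : ℝ))) (Set.Icc 0 1) ∧
    ContinuousOn (Fm m) (Set.Icc (π / ((m : ℝ) + 1)) (π / (m : ℝ))) ∧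
    StrictMonoOn (Fm m) (Set.Icc (π / ((m : ℝ) + 1)) (π / (m : ℝ))) ∧
    Set.BijOn (Fm m) (Set.Icc (π / ((m : ℝ) + 1)) (π / (m : ℝ))) (Set.Icc 0 1) := by
  have hle : π / ((m : ℝ) + 1) ≤ π / (m : ℝ) := by
    have hm' : (2 : ℝ) ≤ m := by exact_mod_cast hm
    gcongr
    linarith
  have hcont := continuousOn_Fm hm
  have hmono := strictMonoOn_Fm hm
  have hmaps : Set.MapsTo (Fm m) (Set.Icc (π / ((m : ℝ) + 1)) (π / (m : ℝ))) (Set.Icc 0 1) := by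
    simpa only [Fm_pi_div_add_one, Fm_pi_div hm] using hmono.monotoneOn.mapsTo_Icc
  have hsurj : Set.SurjOn (Fm m) (Set.Icc (π / ((m : ℝ) + 1)) (π / (m : ℝ))) (Set.Icc 0 1) := by
    simpa only [Set.SurjOn, Fm_pi_div_add_one, Fm_pi_div hm] using
      intermediate_value_Icc hle hcont
  exact ⟨fun φ hφ => cos_sub_one_mul_half_pos hm hφ, hmaps, hcont, hmono,
    hmaps, hmono.injOn, hsurj⟩
end

section
/- Let q ≥ 3 be a prime power and N ≥ q+1 a real number. Consider all finitely supported sequences (c_n)_{n≥1} of nonnegative real numbers satisfying 1 + Σ_{n≥1} 2·c_n·cos(nφ) ≥ 0 for every φ ∈ ℝ. Then the quantity (N−1)·Σ_{n≥1} c_n·q^{−n/2} − Σ_{n≥1} c_n·q^{n/2} attains a maximum over all such sequences, and this maximum equals g_q(N) := 1 + (√q·θ_q(N) − 1)·N / (q − 2√q·θ_q(N) + 1). -/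
open Real Set

/-- The quantity `u(N) = ((q^{(m+1)/2} − q^{(m−1)/2})/(N − 1 − q^{(m−1)/2}) − 1)/√q`. -/
noncomputable def uN (q m : ℕ) (N : ℝ) : ℝ :=
  (((q : ℝ) ^ (((m : ℝ) + 1) / 2) - (q : ℝ) ^ (((m : ℝ) - 1) / 2)) /
      (N - 1 - (q : ℝ) ^ (((m : ℝ) - 1) / 2)) - 1) / Real.sqrt q

/-- `θ` is the function `θ_q`: for every real `N ≥ q+1`, whenever `m ≥ 2` is the integer
with `q^{m/2} ≤ N−1 < q^{(m+1)/2}` and `φ ∈ [π/(m+1), π/m]` satisfies `F_m(φ) = u(N)`,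
then `θ(N) = cos φ`. -/
def IsTheta (q : ℕ) (θ : ℝ → ℝ) : Prop :=
  ∀ N : ℝ, (q : ℝ) + 1 ≤ N → ∀ m : ℕ, 2 ≤ m →
    (q : ℝ) ^ ((m : ℝ) / 2) ≤ N - 1 → N - 1 < (q : ℝ) ^ (((m : ℝ) + 1) / 2) →
    ∀ φ ∈ Set.Icc (π / ((m : ℝ) + 1)) (π / (m : ℝ)),
      Fm m φ = uN q m N → θ N = Real.cos φ

/-- The self-reciprocal polynomial `X^(m+1) + u X^m + u X + 1`. -/
noncomputable def nodePoly (m : ℕ) (u : ℝ) : Polynomial ℂ :=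
  Polynomial.X ^ (m + 1) + Polynomial.C (u : ℂ) * Polynomial.X ^ m
    + Polynomial.C (u : ℂ) * Polynomial.X + 1

lemma eval_nodePoly (m : ℕ) (u : ℝ) (z : ℂ) :
    (nodePoly m u).eval z = z ^ (m + 1) + u * z ^ m + u * z + 1 := by
  simp [nodePoly]

lemma eval_derivative_nodePoly {m : ℕ} (hm : 1 ≤ m) (u : ℝ) (z : ℂ) :
    z * (Polynomial.derivative (nodePoly m u)).eval z
      = (m + 1) * z ^ (m + 1) + u * m * z ^ m + u * z := by
  obtain ⟨k, rfl⟩ : ∃ k, m = k + 1 := ⟨m - 1, by omega⟩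
  simp [nodePoly]
  ring

lemma nodePoly_degree_monic {m : ℕ} (hm : 1 ≤ m) (u : ℝ) :
    (nodePoly m u).natDegree = m + 1 ∧ (nodePoly m u).Monic := by
  have h1 : (Polynomial.C (u : ℂ) * Polynomial.X ^ m
    + Polynomial.C (u : ℂ) * Polynomial.X + 1 : Polynomial ℂ).degree
      < ((m + 1 : ℕ) : WithBot ℕ) := by
    have : (Polynomial.C (u : ℂ) * Polynomial.X ^ m
      + Polynomial.C (u : ℂ) * Polynomial.X + 1 : Polynomial ℂ).natDegree ≤ m := by
      compute_degree!
    refine lt_of_le_of_lt Polynomial.degree_le_natDegree ?_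
    exact_mod_cast Nat.lt_succ_of_le this
  have h2 : nodePoly m u = Polynomial.X ^ (m + 1) + (Polynomial.C (u : ℂ) * Polynomial.X ^ m
    + Polynomial.C (u : ℂ) * Polynomial.X + 1) := by
    simp only [nodePoly]; ring
  have hmon : (nodePoly m u).Monic := by
    rw [h2]; exact Polynomial.monic_X_pow_add h1
  refine ⟨?_, hmon⟩
  rw [h2]
  apply Polynomial.natDegree_eq_of_degree_eq_some
  rw [Polynomial.degree_add_eq_left_of_degree_lt] <;> simp only [Polynomial.degree_X_pow]
  exact h1

lemma norm_eq_one_of_nodePoly_root {m : ℕ} {u : ℝ} (hu0 : 0 ≤ u) (hu1 : u < 1)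
    {z : ℂ} (hz : (nodePoly m u).eval z = 0) : ‖z‖ = 1 := by
  rw [eval_nodePoly] at hz
  have h1 : z ^ m * (z + u) = -(1 + u * z) := by linear_combination hz
  have h2 : ‖z‖ ^ m * ‖z + u‖ = ‖1 + u * z‖ := by
    rw [← norm_pow, ← norm_mul, h1, norm_neg]
  have h3 : ‖z + u‖ ^ 2 - ‖1 + u * z‖ ^ 2 = (‖z‖ ^ 2 - 1) * (1 - u ^ 2) := by
    simp only [← Complex.normSq_eq_norm_sq, Complex.normSq_apply]
    simp
    ring
  have h4 : 0 < 1 - u ^ 2 := by nlinarith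
  have n1 := norm_nonneg z
  have n2 := norm_nonneg (z + u)
  have n3 := norm_nonneg (1 + u * z)
  rcases lt_trichotomy ‖z‖ 1 with h | h | h
  · exfalso
    have h5 : ‖z + u‖ < ‖1 + u * z‖ := by
      apply lt_of_pow_lt_pow_left₀ 2 n3
      have : (‖z‖ ^ 2 - 1) * (1 - u ^ 2) < 0 := mul_neg_of_neg_of_pos (by nlinarith) h4
      linarith
    have h6 : ‖z‖ ^ m ≤ 1 := pow_le_one₀ n1 h.le
    nlinarith
  · exact h
  · exfalso
    have h5 : ‖1 + u * z‖ < ‖z + u‖ := by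
      apply lt_of_pow_lt_pow_left₀ 2 n2
      have : 0 < (‖z‖ ^ 2 - 1) * (1 - u ^ 2) := mul_pos (by nlinarith) h4
      linarith
    have h6 : 1 ≤ ‖z‖ ^ m := one_le_pow₀ h.le
    nlinarith

/-- The weight of the quadrature rule at a root of `nodePoly m u`. -/
noncomputable def nodeWeight (m : ℕ) (u : ℝ) (z : ℂ) : ℝ :=
  1 / (m + (1 - u ^ 2) / Complex.normSq (1 + u * z))

lemma nodePoly_derivative_root {m : ℕ} (hm : 1 ≤ m) {u : ℝ} (hu0 : 0 ≤ u) (hu1 : u < 1)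
    {z : ℂ} (hz : (nodePoly m u).eval z = 0) :
    1 + u * z ≠ 0 ∧ 0 < nodeWeight m u z ∧
      z * (Polynomial.derivative (nodePoly m u)).eval z * nodeWeight m u z = -(1 + u * z) := by
  have hn := norm_eq_one_of_nodePoly_root hu0 hu1 hz
  have hne : 1 + u * z ≠ 0 := by
    intro h
    have h1 : (u : ℂ) * z = -1 := by linear_combination h
    have h2 : ‖(u : ℂ) * z‖ = 1 := by rw [h1]; simp
    rw [norm_mul, hn, Complex.norm_real, Real.norm_of_nonneg hu0] at h2
    linarith
  have hsq : 0 < Complex.normSq (1 + u * z) := Complex.normSq_pos.2 hne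
  have hpos : 0 < (m : ℝ) + (1 - u ^ 2) / Complex.normSq (1 + u * z) := by
    have h1 : (1 : ℝ) ≤ m := by exact_mod_cast hm
    have h2 : 0 ≤ (1 - u ^ 2) / Complex.normSq (1 + u * z) :=
      div_nonneg (by nlinarith) hsq.le
    linarith
  refine ⟨hne, by unfold nodeWeight; positivity, ?_⟩
  rw [eval_derivative_nodePoly hm]
  have hzz : z * (starRingEnd ℂ) z = 1 := by
    rw [Complex.mul_conj, Complex.normSq_eq_norm_sq, hn]; simp
  have hN : (Complex.normSq (1 + u * z) : ℂ) = (1 + u * z) * (1 + u * (starRingEnd ℂ) z) := by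
    rw [← Complex.mul_conj]; simp
  set w := (starRingEnd ℂ) z with hw
  have hne' : 1 + u * w ≠ 0 := by
    intro h
    rw [h, mul_zero] at hN
    exact hsq.ne' (by exact_mod_cast hN)
  rw [eval_nodePoly] at hz
  have hposC : ((m : ℂ) + (1 - u ^ 2) / ((1 + u * z) * (1 + u * w))) ≠ 0 := by
    rw [← hN]; exact_mod_cast hpos.ne'
  have hW : (nodeWeight m u z : ℂ) = 1 / (m + (1 - u ^ 2) / ((1 + u * z) * (1 + u * w))) := by
    rw [nodeWeight, ← hN]; push_cast; rfl
  have hkey : (m + 1) * z ^ (m + 1) + u * m * z ^ m + u * z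
      = -(1 + u * z) * (m + (1 - u ^ 2) / ((1 + u * z) * (1 + u * w))) := by
    have e1 : z ^ (m + 1) * (1 + u * w) = -(1 + u * z) := by
      linear_combination hz + u * z ^ m * hzz
    have e2 : (z ^ (m + 1) + u * z) * (1 + u * w) = -(1 - u ^ 2) := by
      linear_combination e1 + u ^ 2 * hzz
    have e3 : -(1 + u * z) * (m + (1 - u ^ 2) / ((1 + u * z) * (1 + u * w)))
      = - m * (1 + u * z) - (1 - u ^ 2) / (1 + u * w) := by
      field_simp
      ring
    rw [e3, eq_sub_iff_add_eq, ← eq_sub_iff_add_eq', div_eq_iff hne']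
    linear_combination e2 + (1 + u * w) * m * hz
  rw [hkey, hW, mul_assoc, mul_one_div_cancel hposC, mul_one]

lemma nodePoly_eq_nodal {m : ℕ} (hm : 1 ≤ m) {u : ℝ} (hu0 : 0 ≤ u) (hu1 : u < 1) :
    (nodePoly m u).roots.toFinset.card = m + 1 ∧
      nodePoly m u = Lagrange.nodal (nodePoly m u).roots.toFinset id := by
  obtain ⟨hdeg, hmon⟩ := nodePoly_degree_monic hm u
  have hsp := IsAlgClosed.splits (nodePoly m u)
  have hnd : (nodePoly m u).roots.Nodup := by
    rw [Multiset.nodup_iff_count_le_one]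
    intro a
    rw [Polynomial.count_roots]
    by_contra! h
    obtain ⟨h1, h2⟩ := (Polynomial.one_lt_rootMultiplicity_iff_isRoot hmon.ne_zero).1 h
    obtain ⟨h3, -, h4⟩ := nodePoly_derivative_root hm hu0 hu1 h1
    rw [h2.eq_zero, mul_zero, zero_mul, eq_comm, neg_eq_zero] at h4
    exact h3 h4
  constructor
  · rw [Multiset.toFinset_card_of_nodup hnd, ← hdeg, hsp.natDegree_eq_card_roots]
  · conv_lhs => rw [hsp.eq_prod_roots_of_monic hmon]
    rw [Lagrange.nodal, Finset.prod, Multiset.toFinset_val, hnd.dedup]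
    rfl

/-- The quadrature rule with nodes at the roots of `nodePoly m u`: its first moments and its
Cauchy transform. -/
lemma exists_quadrature {m : ℕ} (hm : 1 ≤ m) {u : ℝ} (hu0 : 0 ≤ u) (hu1 : u < 1) :
    ∃ (S : Finset ℂ) (Ω : ℂ → ℝ),
      (∀ z ∈ S, ‖z‖ = 1 ∧ (nodePoly m u).eval z = 0 ∧ 0 ≤ Ω z) ∧
      (∀ n, 1 ≤ n → n < m → ∑ z ∈ S, (Ω z : ℂ) * z ^ n = 0) ∧
      (∑ z ∈ S, (Ω z : ℂ) * z ^ m = -u) ∧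
      (∀ x : ℂ, (nodePoly m u).eval x ≠ 0 →
        ∑ z ∈ S, (Ω z : ℂ) * z / (z - x) = (1 + u * x) / (nodePoly m u).eval x) := by
  obtain ⟨hcard, hnod⟩ := nodePoly_eq_nodal hm hu0 hu1
  obtain ⟨hdeg, hmon⟩ := nodePoly_degree_monic hm u
  set S := (nodePoly m u).roots.toFinset with hS
  have hmem : ∀ z ∈ S, (nodePoly m u).eval z = 0 := by
    intro z hz
    rw [hS, Multiset.mem_toFinset, Polynomial.mem_roots hmon.ne_zero] at hz
    exact hz
  have hΩ : ∀ z ∈ S, (nodeWeight m u z : ℂ) * z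
      = -((1 + u * z) / (Polynomial.derivative (nodePoly m u)).eval z) := by
    intro z hz
    obtain ⟨h1, -, h2⟩ := nodePoly_derivative_root hm hu0 hu1 (hmem z hz)
    have h3 : (Polynomial.derivative (nodePoly m u)).eval z ≠ 0 := by
      intro h
      rw [h, mul_zero, zero_mul, eq_comm, neg_eq_zero] at h2
      exact h1 h2
    rw [← neg_div, eq_div_iff h3]
    linear_combination h2
  have hmom : ∀ p : Polynomial ℂ, p.natDegree ≤ m →
      ∑ z ∈ S, p.eval z / (Polynomial.derivative (nodePoly m u)).eval z = p.coeff m := by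
    intro p hp
    have h := Lagrange.coeff_eq_sum (s := S) (v := id) Function.injective_id.injOn (P := p) (by
      rw [hcard]
      exact lt_of_le_of_lt Polynomial.degree_le_natDegree (by exact_mod_cast Nat.lt_succ_of_le hp))
    rw [hcard, Nat.add_sub_cancel] at h
    rw [h]
    refine Finset.sum_congr rfl fun z hz => ?_
    conv_lhs => rw [hnod]
    rw [show z = id z from rfl, Lagrange.eval_nodal_derivative_eval_node_eq hz,
      Lagrange.eval_nodal]
    rfl
  refine ⟨S, nodeWeight m u, fun z hz => ⟨norm_eq_one_of_nodePoly_root hu0 hu1 (hmem z hz),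
    hmem z hz, (nodePoly_derivative_root hm hu0 hu1 (hmem z hz)).2.1.le⟩, ?_, ?_, ?_⟩
  · intro n hn1 hnm
    obtain ⟨k, rfl⟩ : ∃ k, n = k + 1 := ⟨n - 1, by omega⟩
    have h := hmom (Polynomial.X ^ k + Polynomial.C (u : ℂ) * Polynomial.X ^ (k + 1)) (by
      compute_degree
      omega)
    rw [← neg_eq_zero, ← Finset.sum_neg_distrib]
    convert h using 1
    · refine Finset.sum_congr rfl fun z hz => ?_
      rw [pow_succ', ← mul_assoc, hΩ z hz]
      simp
      ring
    · simp [Polynomial.coeff_X_pow]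
      rw [if_neg (by omega), if_neg (by omega)]
      simp
  · obtain ⟨k, rfl⟩ : ∃ k, m = k + 1 := ⟨m - 1, by omega⟩
    have h := hmom (Polynomial.X ^ k + Polynomial.C (u : ℂ) * Polynomial.X ^ (k + 1)) (by
      compute_degree)
    rw [← neg_inj, ← Finset.sum_neg_distrib, neg_neg]
    convert h using 1
    · refine Finset.sum_congr rfl fun z hz => ?_
      rw [pow_succ', ← mul_assoc, hΩ z hz]
      simp
      ring
    · simp [Polynomial.coeff_X_pow]
  · intro x hx
    set p : Polynomial ℂ := 1 + Polynomial.C (u : ℂ) * Polynomial.X with hp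
    have hpd : p.degree < (S.card : WithBot ℕ) := by
      have : p.natDegree ≤ m := by
        rw [hp]; compute_degree; omega
      rw [hcard]
      exact lt_of_le_of_lt Polynomial.degree_le_natDegree
        (by exact_mod_cast Nat.lt_succ_of_le this)
    have h1 := Lagrange.eq_interpolate (s := S) (v := id) Function.injective_id.injOn hpd
    have h2 := Lagrange.eval_interpolate_not_at_node (s := S) (v := id)
      (fun i => Polynomial.eval (id i) p) (x := x) (by
        rintro i hi rfl
        exact hx (hmem _ hi))
    rw [← h1, ← hnod] at h2
    have h3 : 1 + u * x = p.eval x := by simp [hp]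
    rw [eq_div_iff hx, h3, h2, mul_comm]
    congr 1
    refine Finset.sum_congr rfl fun z hz => ?_
    rw [hΩ z hz, Lagrange.nodalWeight_eq_eval_derivative_nodal hz, ← hnod]
    have hxz : x - z ≠ 0 := by
      intro h
      rw [sub_eq_zero] at h
      exact hx (h ▸ hmem z hz)
    have hzx : z - x ≠ 0 := by
      rw [← neg_sub]; exact neg_ne_zero.2 hxz
    simp [hp]
    rw [← neg_sub x z, div_neg, neg_div, neg_neg]
    field_simp
lemma add_inv_ge {r : ℝ} (hr : 0 < r) (hr3 : 3 ≤ r ^ 2) : 23 / 10 ≤ r + r⁻¹ := by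
  have h : 173 / 100 ≤ r := by nlinarith
  rw [← sub_nonneg]
  have : r + r⁻¹ - 23 / 10 = (r ^ 2 - 23 / 10 * r + 1) / r := by
    field_simp
    ring
  rw [this]
  exact div_nonneg (by nlinarith) hr.le

lemma second_error_nonneg {u ε τ : ℝ} (hu0 : 0 ≤ u) (hu1 : u < 1) (hτ : 23 / 10 ≤ τ)
    (hε : 3 / 10 ≤ ε) : 0 ≤ (1 - u ^ 2) * (ε - u) + τ * ε * u := by
  have h1 : (1 - u ^ 2) * (3 / 10 - u) ≤ (1 - u ^ 2) * (ε - u) :=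
    mul_le_mul_of_nonneg_left (by linarith) (by nlinarith)
  have h2 : 69 / 100 * u ≤ τ * ε * u :=
    mul_le_mul_of_nonneg_right (by nlinarith) hu0
  nlinarith [mul_nonneg hu0 (sq_nonneg (u - 2 / 5)), sq_nonneg (u - 2 / 5)]

lemma second_error_nonneg_of_half {u ε τ : ℝ} (hu0 : 0 ≤ u) (hu1 : u < 1) (hτ : 23 / 10 ≤ τ)
    (hε : 13 / 10 ≤ ε) : 0 ≤ (1 - u ^ 2) * (ε - u) + τ * ε * u - u ^ 2 := by
  have h1 : 0 ≤ (1 - u ^ 2) * (ε - u) := mul_nonneg (by nlinarith) (by linarith)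
  have h2 : 2 * u ≤ τ * ε * u :=
    mul_le_mul_of_nonneg_right (by nlinarith) hu0
  nlinarith

lemma third_error_lower_bound {u ε τ : ℝ} (hu0 : 0 ≤ u) (hu1 : u < 1) (hτ : 23 / 10 ≤ τ)
    (hε : 3 / 10 ≤ ε) : u ≤ ε * (u * (τ ^ 2 - 1) + (1 - u ^ 2) * (τ - u)) := by
  have h1 : 0 ≤ (1 - u ^ 2) * (τ - u) := mul_nonneg (by nlinarith) (by linarith)
  have h2 : 429 / 100 ≤ τ ^ 2 - 1 := by nlinarith
  have h3 : u * (429 / 100) ≤ u * (τ ^ 2 - 1) := mul_le_mul_of_nonneg_left h2 hu0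
  have h4 : 3 / 10 * (u * (429 / 100)) ≤ ε * (u * (τ ^ 2 - 1) + (1 - u ^ 2) * (τ - u)) :=
    mul_le_mul hε (by linarith) (by positivity) (by linarith)
  linarith

lemma third_error_nonneg_of_half {u ε τ : ℝ} (hu0 : 0 ≤ u) (hu1 : u < 1) (hτ : 23 / 10 ≤ τ)
    (hε : 13 / 10 ≤ ε) :
    0 ≤ ε * (u * (τ ^ 2 - 1) + (1 - u ^ 2) * (τ - u)) + u ^ 2 * (1 - u ^ 2)
      + u * (ε - u) * -u + u * (u ^ 2 - 1) - u := by
  have h1 : 0 ≤ (1 - u ^ 2) * (τ - u) := mul_nonneg (by nlinarith) (by linarith)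
  have h2 : 429 / 100 ≤ τ ^ 2 - 1 := by nlinarith
  have h3 : u * (429 / 100) ≤ u * (τ ^ 2 - 1) := mul_le_mul_of_nonneg_left h2 hu0
  have h4 : 13 / 10 * (u * (329 / 100)) ≤ ε * (u * (τ ^ 2 - 1) + (1 - u ^ 2) * (τ - u) - u ^ 2) :=
    mul_le_mul hε (by nlinarith) (by positivity) (by linarith)
  have h5 : 0 ≤ u ^ 2 * (1 - u ^ 2) := mul_nonneg (sq_nonneg u) (by nlinarith)
  have h6 : 0 ≤ u ^ 3 := by positivity
  nlinarith

lemma mass_le {r l c A x : ℝ} (hr : 0 < r) (hr3 : 3 ≤ r ^ 2) (hc : c < 1) (hl0 : 0 ≤ l)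
    (hx : 3 ≤ x) (hl : l ≤ x * r) (hA0 : 0 < A)
    (hA : A * (r + r⁻¹ - 2 * c) = (1 + l) * (r - r⁻¹)) : 1 - l + A ≤ x * r ^ 4 - 1 := by
  have hr1 : 173 / 100 ≤ r := by nlinarith
  have hAle : A * (r - 1) ≤ (1 + l) * (r + 1) := by
    have h1 : A * (r + r⁻¹ - 2) ≤ (1 + l) * (r - r⁻¹) := by
      rw [← hA]
      exact mul_le_mul_of_nonneg_left (by linarith) hA0.le
    have h2 : A * (r + r⁻¹ - 2) = A * (r - 1) * ((r - 1) * r⁻¹) := by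
      field_simp
      ring
    have h3 : (1 + l) * (r - r⁻¹) = (1 + l) * (r + 1) * ((r - 1) * r⁻¹) := by
      field_simp
      ring
    rw [h2, h3] at h1
    exact le_of_mul_le_mul_right h1 (mul_pos (by linarith) (inv_pos.2 hr))
  have h1 : (1 - l + A) * (r - 1) ≤ 2 * r + 2 * (x * r) := by linarith
  have h3 : 519 / 100 ≤ r ^ 3 := by
    have : r ^ 3 = r * r ^ 2 := by ring
    rw [this]
    calc (519 / 100 : ℝ) = 173 / 100 * 3 := by norm_num
      _ ≤ r * r ^ 2 := mul_le_mul hr1 hr3 (by norm_num) hr.le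
  have h5 : 519 / 100 * (x * r) ≤ x * r ^ 4 := by
    have h4 : x * r ^ 4 = r ^ 3 * (x * r) := by ring
    rw [h4]
    exact mul_le_mul_of_nonneg_right h3 (by positivity)
  have h6 : 3 * r ≤ x * r := mul_le_mul_of_nonneg_right hx hr.le
  have h7 : (519 / 100 * (x * r) - 1) * (73 / 100) ≤ (x * r ^ 4 - 1) * (r - 1) :=
    mul_le_mul (by linarith) (by linarith) (by norm_num) (by linarith)
  exact le_of_mul_le_mul_right (h1.trans (by linarith)) (by linarith : 0 < r - 1)

/-- A sequence bounded by its zeroth term and obeying the recurrence of the moments of the extremal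
measure agrees with `r^n - l r^(-n)` for `1 ≤ n < m` and is dominated by it afterwards. -/
lemma moment_comparison {r u c l A : ℝ} {m : ℕ} (hr : 0 < r) (hr3 : 3 ≤ r ^ 2) (hm : 2 ≤ m)
    (hu0 : 0 ≤ u) (hu1 : u < 1) (hc : c < 1) (hc2 : m = 2 → c ≤ 1 / 2)
    (hl0 : 0 ≤ l) (hl : l ≤ r ^ (m + 1)) (hA : A * (r + r⁻¹ - 2 * c) = (1 + l) * (r - r⁻¹))
    {σ s : ℕ → ℝ} (hσ0 : σ 0 = 1) (hσ : ∀ n, 1 ≤ n → n < m → σ n = 0) (hσm : σ m = -u)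
    (hσr : ∀ n, σ (n + m + 1) = -u * σ (n + m) - u * σ (n + 1) - σ n)
    (hs0 : s 0 = 1 - l + A) (hs1 : 2 * s 1 = (r + r⁻¹) * s 0 - 2 * A * c)
    (hsr : ∀ n, s (n + 2) = (r + r⁻¹) * s (n + 1) - s n
      - A * (2 * c * σ (n + 1) - σ (n + 2) - σ n))
    (hsb : ∀ n, s n ≤ s 0) :
    (∀ n, 1 ≤ n → n < m → s n = r ^ n - l / r ^ n) ∧
      ∀ n, 1 ≤ n → s n ≤ r ^ n - l / r ^ n := by
  have hτ := add_inv_ge hr hr3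
  have hr1 : 173 / 100 ≤ r := by nlinarith
  obtain ⟨τ, hτd⟩ : ∃ τ, τ = r + r⁻¹ := ⟨_, rfl⟩
  have hA' := hA
  rw [← hτd] at hA hs1 hsr hτ
  have hu2 : 0 < 1 - u ^ 2 := by nlinarith
  have hri : r⁻¹ * r = 1 := inv_mul_cancel₀ hr.ne'
  have hri1 : r⁻¹ < 1 := inv_lt_one_of_one_lt₀ (by linarith)
  have hri0 : 0 < r⁻¹ := inv_pos.2 hr
  have hε : 3 / 10 < τ - 2 * c := by linarith
  have hApos : 0 < A := by
    have h1 : 0 < A * (τ - 2 * c) := by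
      rw [hA]; exact mul_pos (by linarith) (by linarith)
    exact pos_of_mul_pos_left h1 (by linarith)
  obtain ⟨e, he⟩ : ∃ e : ℕ → ℝ, ∀ n, e n = r ^ n - l / r ^ n - s n := ⟨_, fun _ => rfl⟩
  have e0 : e 0 = -A := by simp [he, hs0]
  have e1 : e 1 = 0 := by
    have : 2 * e 1 = 2 * (r - l * r⁻¹) - 2 * s 1 := by simp [he]; ring
    have h2 : 2 * e 1 = 0 := by
      rw [this, hs1, hs0]
      linear_combination -hA + (l - 1) * hτd
    linarith
  have er : ∀ n, e (n + 2) = τ * e (n + 1) - e n + A * (2 * c * σ (n + 1) - σ (n + 2) - σ n) := by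
    intro n
    have h1 : l / r ^ (n + 2) = τ * (l / r ^ (n + 1)) - l / r ^ n := by
      rw [hτd]; field_simp; ring
    have h2 : r ^ (n + 2) = τ * r ^ (n + 1) - r ^ n := by
      rw [hτd]; field_simp; ring
    simp only [he, hsr]
    rw [h1, h2]; ring
  have ez : ∀ n, 1 ≤ n → n < m → e n = 0 := by
    intro n
    induction n using Nat.strong_induction_on with
    | _ n ih =>
      intro h1 h2
      obtain rfl | rfl | ⟨k, rfl⟩ : n = 1 ∨ n = 2 ∨ ∃ k, n = k + 3 := by
        rcases n with _ | _ | _ | k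
        · omega
        · simp
        · simp
        · exact Or.inr (Or.inr ⟨k, rfl⟩)
      · exact e1
      · rw [er 0, e0, hσ0, hσ _ h1 h2, hσ 1 le_rfl (by omega), e1]; ring
      · rw [er (k + 1), ih (k + 1) (by omega) (by omega) (by omega),
          ih (k + 2) (by omega) (by omega) (by omega), hσ (k + 1 + 1) (by omega) (by omega),
          hσ (k + 1 + 2) h1 h2, hσ (k + 1) (by omega) (by omega)]
        ring
  have em : e m = A * u := by
    obtain rfl | ⟨k, rfl⟩ : m = 2 ∨ ∃ k, m = k + 3 := by
      rcases m with _ | _ | _ | k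
      · omega
      · omega
      · simp
      · exact Or.inr ⟨k, rfl⟩
    · rw [er 0, e0, hσ0, hσm, hσ 1 le_rfl (by omega), e1]; ring
    · rw [er (k + 1), ez (k + 1) (by omega) (by omega), ez (k + 1 + 1) (by omega) (by omega),
        hσ (k + 1 + 1) (by omega) (by omega), show k + 1 + 2 = k + 3 from rfl, hσm,
        hσ (k + 1) (by omega) (by omega)]
      ring
  have s1 : σ (m + 1) = u ^ 2 - 1 := by
    have := hσr 0
    rw [zero_add, zero_add, hσm, hσ0, hσ 1 le_rfl (by omega)] at this
    rw [this]; ring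
  have s2 : σ (m + 2) = u * (1 - u ^ 2) - u * σ 2 := by
    have := hσr 1
    rw [show 1 + m + 1 = m + 2 by ring, show 1 + m = m + 1 by ring, s1,
      hσ 1 le_rfl (by omega)] at this
    rw [this]; ring
  have s3 : σ (m + 3) = -u * σ (m + 2) - u * σ 3 - σ 2 := by
    have := hσr 2
    rwa [show 2 + m + 1 = m + 3 by ring, show 2 + m = m + 2 by ring] at this
  have em1 : e (m + 1) = A * (1 - u ^ 2 + (τ - 2 * c) * u) := by
    obtain ⟨k, rfl⟩ : ∃ k, m = k + 1 := ⟨m - 1, by omega⟩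
    rw [er k, em, ez k (by omega) (by omega), hσm, show k + 2 = k + 1 + 1 from rfl, s1,
      hσ k (by omega) (by omega)]
    ring
  have em2 : e (m + 2) = A * ((1 - u ^ 2) * (τ - 2 * c - u) + τ * (τ - 2 * c) * u + u * σ 2) := by
    rw [er m, em1, em, s1, s2, hσm]; ring
  have em3 : e (m + 3) = A * ((τ - 2 * c) * (u * (τ ^ 2 - 1) + (1 - u ^ 2) * (τ - u))
      + u ^ 2 * (1 - u ^ 2) + u * (τ - 2 * c - u) * σ 2 + u * σ 3 + σ 2) := by
    rw [er (m + 1), em2, em1, show m + 1 + 2 = m + 3 from rfl, show m + 1 + 1 = m + 2 from rfl,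
      s3, s2, s1]
    ring
  have p2 : 0 ≤ e (m + 2) := by
    rw [em2]
    apply mul_nonneg hApos.le
    obtain rfl | hm3 : m = 2 ∨ 2 < m := by omega
    · rw [hσm]
      have := second_error_nonneg_of_half hu0 hu1 hτ (ε := τ - 2 * c) (by linarith [hc2 rfl])
      linarith
    · rw [hσ 2 (by omega) hm3, mul_zero, add_zero]
      exact second_error_nonneg hu0 hu1 hτ hε.le
  have p3 : 0 ≤ e (m + 3) := by
    rw [em3]
    apply mul_nonneg hApos.le
    have hmain := third_error_lower_bound hu0 hu1 hτ hε.le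
    have hu3 : 0 ≤ u ^ 2 * (1 - u ^ 2) := mul_nonneg (sq_nonneg u) hu2.le
    have huu : u * u ≤ u := mul_le_of_le_one_left hu0 hu1.le
    obtain rfl | rfl | hm4 : m = 2 ∨ m = 3 ∨ 3 < m := by omega
    · rw [show (3 : ℕ) = 2 + 1 from rfl, s1, hσm]
      have := third_error_nonneg_of_half hu0 hu1 hτ (ε := τ - 2 * c) (by linarith [hc2 rfl])
      linarith
    · rw [hσm, hσ 2 (by omega) (by omega)]
      linarith
    · rw [hσ 2 (by omega) (by omega), hσ 3 (by omega) (by omega)]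
      linarith
  have p1 : 0 ≤ e (m + 1) := by
    rw [em1]
    exact mul_nonneg hApos.le
      (add_nonneg hu2.le (mul_nonneg (by linarith) hu0))
  have p0 : 0 ≤ e m := by rw [em]; positivity
  refine ⟨fun n h1 h2 => ?_, fun n hn => ?_⟩
  · have := ez n h1 h2
    rw [he] at this
    linarith
  · suffices h : 0 ≤ e n by rw [he] at h; linarith
    obtain h | rfl | rfl | rfl | rfl | ⟨k, rfl⟩ : n < m ∨ n = m ∨ n = m + 1 ∨ n = m + 2 ∨
        n = m + 3 ∨ ∃ k, n = m + 4 + k := by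
      by_cases h : m + 4 ≤ n
      · obtain ⟨k, rfl⟩ := Nat.exists_eq_add_of_le h
        exact Or.inr (Or.inr (Or.inr (Or.inr (Or.inr ⟨k, rfl⟩))))
      · omega
    · exact (ez n hn h).ge
    · exact p0
    · exact p1
    · exact p2
    · exact p3
    · have hsle := hsb (m + 4 + k)
      have hx : 3 ≤ r ^ m := hr3.trans (pow_le_pow_right₀ (by linarith) hm)
      have hle : r ^ (m + 4) ≤ r ^ (m + 4 + k) := pow_le_pow_right₀ (by linarith) (by omega)
      have hdiv : l / r ^ (m + 4 + k) ≤ 1 := by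
        rw [div_le_one (by positivity)]
        exact hl.trans (pow_le_pow_right₀ (by linarith) (by omega))
      have hs0r := mass_le hr hr3 hc hl0 hx (by rwa [pow_succ] at hl) hApos hA'
      have hpow : r ^ (m + 4) = r ^ m * r ^ 4 := pow_add r m 4
      rw [he]
      linarith
lemma pow_eq_of_norm_one {z : ℂ} (hz : ‖z‖ = 1) (n : ℕ) :
    z ^ n = (cos (n * z.arg) : ℂ) + (sin (n * z.arg) : ℂ) * Complex.I := by
  conv_lhs => rw [← Complex.norm_mul_exp_arg_mul_I z, hz]
  rw [Complex.ofReal_one, one_mul, ← Complex.exp_nat_mul, Complex.ofReal_cos, Complex.ofReal_sin,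
    ← Complex.exp_mul_I]
  push_cast
  ring_nf

lemma re_pow_of_norm_one {z : ℂ} (hz : ‖z‖ = 1) (n : ℕ) : (z ^ n).re = cos (n * z.arg) := by
  rw [pow_eq_of_norm_one hz]
  simp [-Complex.ofReal_cos, -Complex.ofReal_sin]

lemma re_le_cos_of_root {m : ℕ} (hm : 2 ≤ m) {u φ : ℝ} (hu0 : 0 ≤ u) (hφ0 : 0 < φ)
    (hφ1 : φ < π / m)
    (hG : cos ((m + 1) * φ / 2) + u * cos ((m - 1) * φ / 2) = 0)
    {z : ℂ} (hz : ‖z‖ = 1) (hroot : (nodePoly m u).eval z = 0) : z.re ≤ cos φ := by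
  have hm2 : (2 : ℝ) ≤ m := by exact_mod_cast hm
  have hre : z.re = cos z.arg := by simpa using re_pow_of_norm_one hz 1
  by_contra! hlt
  rw [hre, ← cos_abs z.arg] at hlt
  have hφπ : φ * m < π := by rwa [lt_div_iff₀ (by linarith)] at hφ1
  have hψ : |z.arg| < φ := by
    by_contra! h
    exact absurd (cos_le_cos_of_nonneg_of_le_pi hφ0.le (Complex.abs_arg_le_pi z) h) (not_le.2 hlt)
  have hψ0 := abs_nonneg z.arg
  set ψ := |z.arg| with hψd
  have h1 : cos ((m + 1) * φ / 2) < cos ((m + 1) * ψ / 2) := by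
    apply cos_lt_cos_of_nonneg_of_le_pi (by positivity) (by nlinarith)
    have : (m + 1) * ψ < (m + 1) * φ := mul_lt_mul_of_pos_left hψ (by linarith)
    linarith
  have h2 : cos ((m - 1) * φ / 2) ≤ cos ((m - 1) * ψ / 2) := by
    have : (m - 1) * ψ ≤ (m - 1) * φ := mul_le_mul_of_nonneg_left hψ.le (by linarith)
    have h0 : 0 ≤ (m - 1) * ψ := mul_nonneg (by linarith) hψ0
    exact cos_le_cos_of_nonneg_of_le_pi (by linarith) (by nlinarith) (by linarith)
  have h3 : 0 < cos ((m + 1) * ψ / 2) + u * cos ((m - 1) * ψ / 2) := by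
    nlinarith
  have habs : ∀ t : ℝ, cos (t * ψ / 2) = cos (t * z.arg / 2) := by
    intro t
    rcases abs_choice z.arg with h | h
    · rw [hψd, h]
    · rw [hψd, h, ← cos_neg]; ring_nf
  rw [habs, habs] at h3
  rw [eval_nodePoly] at hroot
  have e1 := pow_eq_of_norm_one hz (m + 1)
  have e2 := pow_eq_of_norm_one hz m
  have e3 := pow_eq_of_norm_one hz 1
  rw [pow_one] at e3
  generalize z.arg = α at *
  rw [e1, e2, e3] at hroot
  have hR := congrArg Complex.re hroot
  have hI := congrArg Complex.im hroot
  simp [-Complex.ofReal_cos, -Complex.ofReal_sin] at hR hI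
  set p := (m + 1) * α / 2 with hp
  set t := (m - 1) * α / 2 with ht
  have a1 : (m + 1) * α = 2 * p := by rw [hp]; ring
  have a2 : m * α = p + t := by rw [hp, ht]; ring
  have a3 : α = p - t := by rw [hp, ht]; ring
  rw [a1, a2, cos_two_mul, cos_add] at hR
  rw [a1, a2, sin_two_mul, sin_add] at hI
  have c3 : cos α = cos p * cos t + sin p * sin t := by rw [a3, cos_sub]
  have s3 : sin α = sin p * cos t - cos p * sin t := by rw [a3, sin_sub]
  rw [c3] at hR
  rw [s3] at hI
  have hR' : cos p * (cos p + u * cos t) = 0 := by linarith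
  have hI' : sin p * (cos p + u * cos t) = 0 := by linarith
  have hc := (mul_eq_zero.1 hR').resolve_right h3.ne'
  have hs := (mul_eq_zero.1 hI').resolve_right h3.ne'
  have := sin_sq_add_cos_sq p
  rw [hc, hs] at this
  norm_num at this

/-- The coefficients of the quotient of `nodePoly m u` by `X^2 - 2 cos φ X + 1`. -/
noncomputable def quotCoeff (u φ : ℝ) (k : ℕ) : ℝ :=
  (sin ((k + 1) * φ) + u * sin (k * φ)) / sin φ

lemma quotCoeff_zero {u φ : ℝ} (hs : sin φ ≠ 0) : quotCoeff u φ 0 = 1 := by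
  simp [quotCoeff, hs]

lemma quotCoeff_one {u φ : ℝ} (hs : sin φ ≠ 0) : quotCoeff u φ 1 = 2 * cos φ + u := by
  have h : (((1 : ℕ) : ℝ) + 1) * φ = 2 * φ := by norm_num
  rw [quotCoeff, h, sin_two_mul]
  field_simp
  simp
  ring

lemma quotCoeff_add_two (u φ : ℝ) (k : ℕ) :
    quotCoeff u φ (k + 2) = 2 * cos φ * quotCoeff u φ (k + 1) - quotCoeff u φ k := by
  have h1 : (((k + 2 : ℕ) : ℝ) + 1) * φ = ((k + 2) * φ) + φ := by push_cast; ring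
  have h2 : ((k + 2 : ℕ) : ℝ) * φ = ((k + 1) * φ) + φ := by push_cast; ring
  have h3 : (((k + 1 : ℕ) : ℝ) + 1) * φ = (k + 2) * φ := by push_cast; ring
  have h4 : ((k + 1 : ℕ) : ℝ) * φ = (k + 1) * φ := by push_cast; ring
  have h5 : ((k : ℝ) + 1) * φ = (k + 2) * φ - φ := by ring
  have h6 : (k : ℝ) * φ = (k + 1) * φ - φ := by ring
  simp only [quotCoeff, h1, h2, h3, h4]
  rw [h6, sin_add, sin_add, sin_sub]
  have h7 : sin ((k + 1) * φ) = sin ((k + 2) * φ) * cos φ - cos ((k + 2) * φ) * sin φ := by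
    rw [h5, sin_sub]
  ring_nf at h7 ⊢
  rw [h7]
  ring

lemma quotCoeff_end {m : ℕ} (hm : 1 ≤ m) {u φ : ℝ} (hs : sin φ ≠ 0)
    (hG : cos ((m + 1) * φ / 2) + u * cos ((m - 1) * φ / 2) = 0) :
    quotCoeff u φ m = -u ∧ quotCoeff u φ (m - 1) = 1 := by
  have hm1 : ((m - 1 : ℕ) : ℝ) = m - 1 := by push_cast [Nat.cast_sub hm]; ring
  simp only [quotCoeff, hm1]
  set p := (m + 1) * φ / 2 with hp
  set t := (m - 1) * φ / 2 with ht
  have a1 : (m + 1) * φ = 2 * p := by rw [hp]; ring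
  have a2 : m * φ = p + t := by rw [hp, ht]; ring
  have a4 : (m - 1) * φ = 2 * t := by rw [ht]; ring
  have a5 : ((m : ℝ) - 1 + 1) * φ = p + t := by rw [hp, ht]; ring
  have s3 : sin φ = sin p * cos t - cos p * sin t := by
    rw [← sin_sub]; congr 1; rw [hp, ht]; ring
  rw [a1, a2, a4, a5, div_eq_iff hs, div_eq_iff hs, s3, sin_two_mul, sin_two_mul, sin_add]
  constructor
  · linear_combination 2 * sin p * hG
  · linear_combination 2 * sin t * hG

lemma quotCoeff_telescope {u φ : ℝ} (hs : sin φ ≠ 0) (z : ℂ) (n : ℕ) :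
    (z ^ 2 - 2 * (cos φ : ℝ) * z + 1) * ∑ k ∈ Finset.range (n + 1), (quotCoeff u φ k : ℂ) * z ^ k
      = 1 + u * z - (quotCoeff u φ (n + 1) : ℝ) * z ^ (n + 1)
        + (quotCoeff u φ n : ℝ) * z ^ (n + 2) := by
  induction n with
  | zero =>
    rw [Finset.sum_range_one, quotCoeff_zero hs, zero_add, quotCoeff_one hs]
    push_cast
    ring
  | succ n ih =>
    rw [Finset.sum_range_succ, mul_add, ih, quotCoeff_add_two]
    push_cast
    ring

lemma nodePoly_eq_mul {m : ℕ} (hm : 1 ≤ m) {u φ : ℝ} (hs : sin φ ≠ 0)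
    (hG : cos ((m + 1) * φ / 2) + u * cos ((m - 1) * φ / 2) = 0) (z : ℂ) :
    (nodePoly m u).eval z = (z ^ 2 - 2 * (cos φ : ℝ) * z + 1) *
      ∑ k ∈ Finset.range m, (quotCoeff u φ k : ℂ) * z ^ k := by
  obtain ⟨n, rfl⟩ : ∃ n, m = n + 1 := ⟨m - 1, by omega⟩
  obtain ⟨h1, h2⟩ := quotCoeff_end hm hs hG
  rw [Nat.add_sub_cancel] at h2
  rw [quotCoeff_telescope hs, h1, h2, eval_nodePoly]
  push_cast
  ring

lemma poisson_sum {m : ℕ} {u r l : ℝ} (hu0 : 0 ≤ u) (hr : 1 < r)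
    (hl : l = r ^ m * (r + u) / (1 + r * u)) {S : Finset ℂ} {Ω : ℂ → ℝ}
    (hS : ∀ z ∈ S, ‖z‖ = 1)
    (hC : ∀ x : ℂ, (nodePoly m u).eval x ≠ 0 →
        ∑ z ∈ S, (Ω z : ℂ) * z / (z - x) = (1 + u * x) / (nodePoly m u).eval x) :
    ∑ z ∈ S, Ω z / (r + r⁻¹ - 2 * z.re) = (l - 1) / ((1 + l) * (r - r⁻¹)) := by
  have hr0 : 0 < r := by linarith
  have hri1 : r⁻¹ < 1 := inv_lt_one_of_one_lt₀ hr
  have hri0 : 0 < r⁻¹ := inv_pos.2 hr0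
  obtain ⟨ρ, hρ⟩ : ∃ ρ : ℝ, ρ = r ^ (m + 1) + u * r ^ m + u * r + 1 := ⟨_, rfl⟩
  have hρ0 : 0 < ρ := by rw [hρ]; positivity
  have hru : 0 < 1 + r * u := by positivity
  have e1 : (nodePoly m u).eval (r : ℂ) = (ρ : ℝ) := by
    rw [eval_nodePoly, hρ]; push_cast; ring
  have e2 : (nodePoly m u).eval ((r⁻¹ : ℝ) : ℂ) = (ρ / r ^ (m + 1) : ℝ) := by
    rw [eval_nodePoly, hρ]
    norm_cast
    simp only [inv_pow]
    field_simp
    ring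
  have t1 := hC r (by rw [e1]; exact_mod_cast hρ0.ne')
  have t2 := hC (r⁻¹ : ℝ) (by rw [e2]; exact_mod_cast (by positivity))
  rw [e1] at t1
  rw [e2] at t2
  have key : ∀ z ∈ S, ((Ω z / (r + r⁻¹ - 2 * z.re) : ℝ) : ℂ)
      = ((Ω z : ℂ) * z / (z - (r⁻¹ : ℝ)) - (Ω z : ℂ) * z / (z - r)) / ((r - r⁻¹ : ℝ) : ℂ) := by
    intro z hz
    have hn := hS z hz
    have hzz : z * (starRingEnd ℂ) z = 1 := by
      rw [Complex.mul_conj, Complex.normSq_eq_norm_sq, hn]; simp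
    have hre : (2 * z.re : ℂ) = z + (starRingEnd ℂ) z := by
      rw [Complex.add_conj]; push_cast; rfl
    have hz0 : z ≠ 0 := by intro h; simp [h] at hn
    have h1 : z - r ≠ 0 := by
      intro h
      rw [sub_eq_zero] at h
      rw [h, Complex.norm_real, Real.norm_of_nonneg hr0.le] at hn
      linarith
    have h2 : z - (r⁻¹ : ℝ) ≠ 0 := by
      intro h
      rw [sub_eq_zero] at h
      rw [h, Complex.norm_real, Real.norm_of_nonneg hri0.le] at hn
      linarith
    have h3 : ((r - r⁻¹ : ℝ) : ℂ) ≠ 0 := by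
      have : r - r⁻¹ ≠ 0 := by linarith
      exact_mod_cast this
    have hrr : (r : ℂ) * (r⁻¹ : ℝ) = 1 := by
      exact_mod_cast mul_inv_cancel₀ hr0.ne'
    have h4 : (z - r) * (z - (r⁻¹ : ℝ)) = -z * ((r : ℂ) + (r⁻¹ : ℝ) - 2 * z.re) := by
      rw [hre]
      linear_combination hrr - hzz
    have h5 : ((r : ℂ) + (r⁻¹ : ℝ) - 2 * z.re) ≠ 0 := by
      intro h
      rw [h, mul_zero] at h4
      exact (mul_ne_zero h1 h2) h4
    rw [div_sub_div _ _ h2 h1, div_div, eq_div_iff (mul_ne_zero (mul_ne_zero h2 h1) h3)]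
    rw [Complex.ofReal_div, Complex.ofReal_sub, Complex.ofReal_add, Complex.ofReal_mul,
      Complex.ofReal_ofNat, Complex.ofReal_sub, div_mul_eq_mul_div, div_eq_iff h5]
    linear_combination (Ω z : ℂ) * ((r : ℂ) - (r⁻¹ : ℝ)) * h4
  have hsum : ((∑ z ∈ S, Ω z / (r + r⁻¹ - 2 * z.re) : ℝ) : ℂ)
      = (((1 + u * r⁻¹) / (ρ / r ^ (m + 1)) - (1 + u * r) / ρ) / (r - r⁻¹) : ℝ) := by
    rw [Complex.ofReal_sum, Finset.sum_congr rfl key, ← Finset.sum_div, Finset.sum_sub_distrib,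
      t1, t2]
    push_cast
    rfl
  rw [Complex.ofReal_inj.1 hsum]
  have h1l : 1 + l = ρ / (1 + r * u) := by
    rw [hl, hρ]; field_simp; ring
  have hl1 : l - 1 = (r ^ m * (r + u) - (1 + r * u)) / (1 + r * u) := by
    rw [hl]; field_simp
  rw [h1l, hl1, ← div_div]
  congr 1
  field_simp
  ring

lemma re_pow_recurrence {z : ℂ} (hz : ‖z‖ = 1) (n : ℕ) :
    (z ^ (n + 2)).re = 2 * z.re * (z ^ (n + 1)).re - (z ^ n).re := by
  have hzz : z * (starRingEnd ℂ) z = 1 := by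
    rw [Complex.mul_conj, Complex.normSq_eq_norm_sq, hz]; simp
  have hre : ((2 * z.re : ℝ) : ℂ) = z + (starRingEnd ℂ) z := (Complex.add_conj z).symm
  have h : z ^ (n + 2) = ((2 * z.re : ℝ) : ℂ) * z ^ (n + 1) - z ^ n := by
    rw [hre]
    linear_combination -z ^ n * hzz
  rw [h, Complex.sub_re, Complex.re_ofReal_mul]

lemma re_pow_le_one {z : ℂ} (hz : ‖z‖ = 1) (n : ℕ) : (z ^ n).re ≤ 1 := by
  rw [re_pow_of_norm_one hz]
  exact cos_le_one _

/-- The extremal measure, supported on the zeros of the extremal trigonometric polynomial. -/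
lemma exists_extremal_measure {r u φ l A : ℝ} {m : ℕ} (hr : 0 < r) (hr3 : 3 ≤ r ^ 2) (hm : 2 ≤ m)
    (hu0 : 0 ≤ u) (hu1 : u < 1) (hφ0 : π / (m + 1) ≤ φ) (hφ1 : φ < π / m)
    (hG : cos ((m + 1) * φ / 2) + u * cos ((m - 1) * φ / 2) = 0)
    (hl : l = r ^ m * (r + u) / (1 + r * u))
    (hA : A * (r + r⁻¹ - 2 * cos φ) = (1 + l) * (r - r⁻¹)) :
    ∃ (S : Finset ℂ) (w : ℂ → ℝ),
      (∀ z ∈ S, ‖z‖ = 1 ∧ 0 ≤ w z ∧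
        (w z = 0 ∨ ∑ k ∈ Finset.range m, (quotCoeff u φ k : ℂ) * z ^ k = 0)) ∧
      2 * ∑ z ∈ S, w z = 1 - l + A ∧
      (∀ n, 1 ≤ n → n < m → 2 * ∑ z ∈ S, w z * (z ^ n).re = r ^ n - l / r ^ n) ∧
      ∀ n, 1 ≤ n → 2 * ∑ z ∈ S, w z * (z ^ n).re ≤ r ^ n - l / r ^ n := by
  have hm2 : (2 : ℝ) ≤ m := by exact_mod_cast hm
  have hφpos : 0 < φ := lt_of_lt_of_le (by positivity) hφ0
  have hφm : φ * m < π := by rwa [lt_div_iff₀ (by linarith)] at hφ1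
  have hφπ : φ < π := by nlinarith
  have hsin : sin φ ≠ 0 := (sin_pos_of_pos_of_lt_pi hφpos hφπ).ne'
  have hc : cos φ < 1 := by
    rw [← cos_zero]
    exact cos_lt_cos_of_nonneg_of_le_pi le_rfl hφπ.le hφpos
  have hc2 : m = 2 → cos φ ≤ 1 / 2 := by
    rintro rfl
    rw [← cos_pi_div_three]
    apply cos_le_cos_of_nonneg_of_le_pi (by positivity) hφπ.le
    norm_num at hφ0
    exact hφ0
  have hr1 : 1 < r := by nlinarith
  have hτ := add_inv_ge hr hr3
  have hri1 : r⁻¹ < 1 := inv_lt_one_of_one_lt₀ hr1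
  have hru : 0 < 1 + r * u := by positivity
  have hl0 : 0 ≤ l := by rw [hl]; positivity
  have hlr : l ≤ r ^ (m + 1) := by
    rw [hl, div_le_iff₀ hru, pow_succ, mul_assoc]
    apply mul_le_mul_of_nonneg_left _ (by positivity)
    nlinarith
  obtain ⟨S, Ω, hS, hσ, hσm, hC⟩ := exists_quadrature (by omega : 1 ≤ m) hu0 hu1
  have hpois := poisson_sum hu0 hr1 hl (fun z hz => (hS z hz).1) hC
  have hσ0 : ∑ z ∈ S, Ω z = 1 := by
    have h := hC 0 (by rw [eval_nodePoly]; simp [show m ≠ 0 by omega])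
    rw [eval_nodePoly] at h
    have h2 : ∑ z ∈ S, (Ω z : ℂ) * z / (z - 0) = ((∑ z ∈ S, Ω z : ℝ) : ℂ) := by
      push_cast
      refine Finset.sum_congr rfl fun z hz => ?_
      have hz0 : z ≠ 0 := by
        intro h; have := (hS z hz).1; simp [h] at this
      rw [sub_zero, mul_div_cancel_right₀ _ hz0]
    rw [h2] at h
    have h3 : ((∑ z ∈ S, Ω z : ℝ) : ℂ) = ((1 : ℝ) : ℂ) := by
      rw [h]; simp [show m ≠ 0 by omega]
    exact Complex.ofReal_inj.1 h3
  have hre : ∀ n, ∑ z ∈ S, Ω z * (z ^ n).re = (∑ z ∈ S, (Ω z : ℂ) * z ^ n).re := by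
    intro n
    rw [Complex.re_sum]
    exact Finset.sum_congr rfl fun z _ => (Complex.re_ofReal_mul _ _).symm
  have hD : ∀ z ∈ S, 0 < r + r⁻¹ - 2 * z.re := by
    intro z hz
    have := re_pow_le_one (hS z hz).1 1
    rw [pow_one] at this
    linarith
  have hApos : 0 ≤ A := by
    have h1 : 0 < A * (r + r⁻¹ - 2 * cos φ) := by
      rw [hA]; exact mul_pos (by linarith) (by linarith)
    exact (pos_of_mul_pos_left h1 (by linarith)).le
  obtain ⟨w, hw⟩ : ∃ w : ℂ → ℝ, ∀ z,
    w z = A * ((cos φ - z.re) * (Ω z / (r + r⁻¹ - 2 * z.re))) := ⟨_, fun _ => rfl⟩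
  have hwD : ∀ z ∈ S, w z * (r + r⁻¹ - 2 * z.re) = A * ((cos φ - z.re) * Ω z) := by
    intro z hz
    rw [hw, mul_assoc, mul_assoc, div_mul_cancel₀ _ (hD z hz).ne']
  have hw0 : ∀ z ∈ S, 0 ≤ w z := by
    intro z hz
    rw [hw]
    have := re_le_cos_of_root hm hu0 hφpos hφ1 hG (hS z hz).1 (hS z hz).2.1
    exact mul_nonneg hApos (mul_nonneg (by linarith) (div_nonneg (hS z hz).2.2 (hD z hz).le))
  have hmass : 2 * ∑ z ∈ S, w z = 1 - l + A := by
    have h1 : ∀ z ∈ S, 2 * w z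
        = A * Ω z - A * (r + r⁻¹ - 2 * cos φ) * (Ω z / (r + r⁻¹ - 2 * z.re)) := by
      intro z hz
      rw [hw]
      have hq : Ω z / (r + r⁻¹ - 2 * z.re) * (r + r⁻¹ - 2 * z.re) = Ω z :=
        div_mul_cancel₀ _ (hD z hz).ne'
      linear_combination A * hq
    rw [Finset.mul_sum, Finset.sum_congr rfl h1, Finset.sum_sub_distrib, ← Finset.mul_sum,
      ← Finset.mul_sum, hσ0, hpois, hA, mul_div_cancel₀]
    · ring
    · exact mul_ne_zero (by linarith) (by linarith)
  refine ⟨S, w, fun z hz => ⟨(hS z hz).1, hw0 z hz, ?_⟩, hmass, ?_⟩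
  · have h := (hS z hz).2.1
    rw [nodePoly_eq_mul (by omega) hsin hG] at h
    refine (mul_eq_zero.1 h).imp (fun h => ?_) id
    have hn := (hS z hz).1
    have h2 := re_pow_recurrence hn 0
    have h3 := congrArg Complex.re h
    have h4 : (z ^ 2).re = 2 * z.re * z.re - 1 := by simpa using h2
    have h5 : ((2 : ℂ) * (cos φ : ℝ) * z).re = 2 * cos φ * z.re := by
      rw [← Complex.ofReal_ofNat, ← Complex.ofReal_mul, Complex.re_ofReal_mul]
    have hi := congrArg Complex.im h
    have h6 : ((2 : ℂ) * (cos φ : ℝ) * z).im = 2 * cos φ * z.im := by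
      rw [← Complex.ofReal_ofNat, ← Complex.ofReal_mul, Complex.im_ofReal_mul]
    have h7 : (z ^ 2).im = 2 * z.re * z.im := by rw [sq, Complex.mul_im]; ring
    rw [Complex.add_re, Complex.sub_re, h4, h5] at h3
    rw [Complex.add_im, Complex.sub_im, h6, h7] at hi
    simp only [Complex.one_re, Complex.zero_re, Complex.one_im, Complex.zero_im] at h3 hi
    have h8 : z.re * (z.re - cos φ) = 0 := by linarith
    have h9 : z.im * (z.re - cos φ) = 0 := by linarith
    have h10 : z.re - cos φ = 0 := by
      by_contra hne
      have a := (mul_eq_zero.1 h8).resolve_right hne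
      have b := (mul_eq_zero.1 h9).resolve_right hne
      have : z = 0 := Complex.ext a b
      simp [this] at hn
    rw [hw]
    have : cos φ - z.re = 0 := by linarith
    rw [this]; ring
  · apply moment_comparison (σ := fun n => ∑ z ∈ S, Ω z * (z ^ n).re)
      (s := fun n => 2 * ∑ z ∈ S, w z * (z ^ n).re) hr hr3 hm hu0 hu1 hc hc2 hl0 hlr hA
    · simpa using hσ0
    · intro n h1 h2
      rw [hre, hσ n h1 h2, Complex.zero_re]
    · rw [hre, hσm]; simp
    · intro n
      rw [Finset.mul_sum, Finset.mul_sum, ← Finset.sum_sub_distrib, ← Finset.sum_sub_distrib]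
      refine Finset.sum_congr rfl fun z hz => ?_
      have h := (hS z hz).2.1
      rw [eval_nodePoly] at h
      have h2 : z ^ (n + m + 1) = ((-u : ℝ) : ℂ) * z ^ (n + m) - (u : ℝ) * z ^ (n + 1) - z ^ n := by
        push_cast
        linear_combination z ^ n * h
      rw [h2, Complex.sub_re, Complex.sub_re, Complex.re_ofReal_mul, Complex.re_ofReal_mul]
      ring
    · simpa using hmass
    · have h1 : ∑ z ∈ S, Ω z * (z ^ 1).re = 0 := by
        rw [hre, hσ 1 le_rfl (by omega), Complex.zero_re]
      have h2 : A * (cos φ * ∑ z ∈ S, Ω z - ∑ z ∈ S, Ω z * (z ^ 1).re)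
          = (r + r⁻¹) * (∑ z ∈ S, w z * (z ^ 0).re) - 2 * ∑ z ∈ S, w z * (z ^ 1).re := by
        simp only [Finset.mul_sum, ← Finset.sum_sub_distrib]
        refine Finset.sum_congr rfl fun z hz => ?_
        have := hwD z hz
        simp only [pow_zero, pow_one, Complex.one_re]
        linear_combination -this
      rw [h1, hσ0] at h2
      linear_combination 2 * h2
    · intro n
      have h2 : A * (2 * cos φ * (∑ z ∈ S, Ω z * (z ^ (n + 1)).re)
            - (∑ z ∈ S, Ω z * (z ^ (n + 2)).re) - ∑ z ∈ S, Ω z * (z ^ n).re)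
          = (r + r⁻¹) * (2 * ∑ z ∈ S, w z * (z ^ (n + 1)).re)
            - 2 * (∑ z ∈ S, w z * (z ^ n).re) - 2 * ∑ z ∈ S, w z * (z ^ (n + 2)).re := by
        simp only [Finset.mul_sum, ← Finset.sum_sub_distrib]
        refine Finset.sum_congr rfl fun z hz => ?_
        have := hwD z hz
        rw [re_pow_recurrence (hS z hz).1 n]
        linear_combination -2 * (z ^ (n + 1)).re * this
      linear_combination h2
    · intro n
      have : ∑ z ∈ S, w z * (z ^ n).re ≤ ∑ z ∈ S, w z * (z ^ 0).re := by
        refine Finset.sum_le_sum fun z hz => ?_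
        apply mul_le_mul_of_nonneg_left _ (hw0 z hz)
        simpa using re_pow_le_one (hS z hz).1 n
      linarith


lemma sum_le_of_measure {r l a : ℝ} {S : Finset ℂ} {w : ℂ → ℝ}
    (hS : ∀ z ∈ S, ‖z‖ = 1 ∧ 0 ≤ w z) (h0 : 2 * ∑ z ∈ S, w z = a)
    (hle : ∀ n, 1 ≤ n → 2 * ∑ z ∈ S, w z * (z ^ n).re ≤ r ^ n - l / r ^ n)
    {c : ℕ →₀ ℝ} (hc : ∀ n, 0 ≤ c n) (hc0 : c 0 = 0)
    (hpos : ∀ φ : ℝ, 0 ≤ 1 + ∑ n ∈ c.support, 2 * c n * cos ((n : ℝ) * φ)) :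
    ∑ n ∈ c.support, c n * (l / r ^ n - r ^ n) ≤ a / 2 := by
  have h1 : 0 ≤ ∑ z ∈ S, w z * (1 + ∑ n ∈ c.support, 2 * c n * cos ((n : ℝ) * z.arg)) :=
    Finset.sum_nonneg fun z hz => mul_nonneg (hS z hz).2 (hpos _)
  have h2 : ∑ z ∈ S, w z * (1 + ∑ n ∈ c.support, 2 * c n * cos ((n : ℝ) * z.arg))
      = ∑ z ∈ S, w z + ∑ n ∈ c.support, c n * (2 * ∑ z ∈ S, w z * (z ^ n).re) := by
    simp only [mul_add, mul_one, Finset.sum_add_distrib, Finset.mul_sum]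
    rw [Finset.sum_comm]
    congr 1
    refine Finset.sum_congr rfl fun n _ => Finset.sum_congr rfl fun z hz => ?_
    rw [re_pow_of_norm_one (hS z hz).1]
    ring
  have h3 : ∑ n ∈ c.support, c n * (2 * ∑ z ∈ S, w z * (z ^ n).re)
      ≤ ∑ n ∈ c.support, c n * (r ^ n - l / r ^ n) := by
    refine Finset.sum_le_sum fun n hn => mul_le_mul_of_nonneg_left (hle n ?_) (hc n)
    rcases Nat.eq_zero_or_pos n with rfl | h
    · simp [hc0] at hn
    · exact h
  have h4 : ∑ n ∈ c.support, c n * (l / r ^ n - r ^ n)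
      = -∑ n ∈ c.support, c n * (r ^ n - l / r ^ n) := by
    rw [← Finset.sum_neg_distrib]
    exact Finset.sum_congr rfl fun n _ => by ring
  linarith

/-- The Toeplitz quadratic form of `h` at the coefficient vector `P 0, …, P (m - 1)`. -/
noncomputable def toeplitzForm (m : ℕ) (P h : ℕ → ℝ) : ℝ :=
  ∑ j ∈ Finset.range m, ∑ k ∈ Finset.range m, P j * P k * h (Nat.dist j k)

lemma cos_dist_mul (j k : ℕ) (α : ℝ) :
    cos ((Nat.dist j k : ℝ) * α) = cos (j * α) * cos (k * α) + sin (j * α) * sin (k * α) := by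
  rw [← cos_sub, ← sub_mul]
  rcases le_total j k with h | h
  · rw [Nat.dist_eq_sub_of_le h, Nat.cast_sub h, ← cos_neg]
    ring_nf
  · rw [Nat.dist_eq_sub_of_le_right h, Nat.cast_sub h]

lemma toeplitzForm_cos (m : ℕ) (P : ℕ → ℝ) (α : ℝ) :
    toeplitzForm m P (fun n => cos (n * α)) = (∑ k ∈ Finset.range m, P k * cos (k * α)) ^ 2
      + (∑ k ∈ Finset.range m, P k * sin (k * α)) ^ 2 := by
  rw [toeplitzForm, sq, sq, Finset.sum_mul_sum, Finset.sum_mul_sum, ← Finset.sum_add_distrib]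
  refine Finset.sum_congr rfl fun j _ => ?_
  rw [← Finset.sum_add_distrib]
  refine Finset.sum_congr rfl fun k _ => ?_
  rw [cos_dist_mul]
  ring

lemma toeplitzForm_re_pow_eq_zero {m : ℕ} {P : ℕ → ℝ} {z : ℂ} (hz : ‖z‖ = 1)
    (h : ∑ k ∈ Finset.range m, (P k : ℂ) * z ^ k = 0) :
    toeplitzForm m P (fun n => (z ^ n).re) = 0 := by
  simp only [re_pow_of_norm_one hz]
  rw [toeplitzForm_cos]
  have hr := congrArg Complex.re h
  have hi := congrArg Complex.im h
  simp only [pow_eq_of_norm_one hz, Complex.re_sum, Complex.im_sum, Complex.re_ofReal_mul,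
    Complex.im_ofReal_mul, Complex.add_re, Complex.add_im, Complex.ofReal_re, Complex.ofReal_im,
    Complex.I_re, Complex.I_im, Complex.zero_re, Complex.zero_im, mul_zero, mul_one, zero_add,
    add_zero] at hr hi
  rw [hr, hi]
  norm_num

lemma toeplitzForm_eq_zero_of_measure {m : ℕ} {r l a : ℝ} {P : ℕ → ℝ} {S : Finset ℂ} {w : ℂ → ℝ}
    (hS : ∀ z ∈ S, ‖z‖ = 1 ∧ 0 ≤ w z ∧
        (w z = 0 ∨ ∑ k ∈ Finset.range m, (P k : ℂ) * z ^ k = 0))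
    (h0 : 2 * ∑ z ∈ S, w z = a)
    (heq : ∀ n, 1 ≤ n → n < m → 2 * ∑ z ∈ S, w z * (z ^ n).re = r ^ n - l / r ^ n) :
    toeplitzForm m P (fun n => if n = 0 then a else r ^ n - l / r ^ n) = 0 := by
  have h1 : toeplitzForm m P (fun n => if n = 0 then a else r ^ n - l / r ^ n)
      = toeplitzForm m P (fun n => 2 * ∑ z ∈ S, w z * (z ^ n).re) := by
    refine Finset.sum_congr rfl fun j hj => Finset.sum_congr rfl fun k hk => ?_
    congr 1
    rw [Finset.mem_range] at hj hk
    have hd : Nat.dist j k < m := by rw [Nat.dist]; omega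
    by_cases h : Nat.dist j k = 0
    · simp [h, ← h0]
    · simpa only [if_neg h] using (heq _ (Nat.one_le_iff_ne_zero.2 h) hd).symm
  have h2 : toeplitzForm m P (fun n => 2 * ∑ z ∈ S, w z * (z ^ n).re)
      = 2 * ∑ z ∈ S, w z * toeplitzForm m P (fun n => (z ^ n).re) := by
    simp only [toeplitzForm, Finset.mul_sum]
    symm
    rw [Finset.sum_comm]
    refine Finset.sum_congr rfl fun j _ => ?_
    rw [Finset.sum_comm]
    exact Finset.sum_congr rfl fun k _ => Finset.sum_congr rfl fun z _ => by ring
  rw [h1, h2, Finset.sum_eq_zero, mul_zero]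
  intro z hz
  rcases (hS z hz).2.2 with h | h
  · rw [h, zero_mul]
  · rw [toeplitzForm_re_pow_eq_zero (hS z hz).1 h, mul_zero]

/-- The coefficients of the cosine polynomial `|∑ P k e^{ikφ}|^2 / ∑ P k ^ 2`. -/
noncomputable def fejerCoeff (m : ℕ) (P : ℕ → ℝ) : ℕ →₀ ℝ :=
  (∑ j ∈ Finset.range m, ∑ k ∈ Finset.range m,
    Finsupp.single (Nat.dist j k)
      (P j * P k / (2 * ∑ i ∈ Finset.range m, P i ^ 2))).erase 0

lemma fejerCoeff_zero (m : ℕ) (P : ℕ → ℝ) : fejerCoeff m P 0 = 0 := by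
  rw [fejerCoeff, Finsupp.erase_same]

lemma fejerCoeff_nonneg {m : ℕ} {P : ℕ → ℝ} (hP : ∀ k < m, 0 ≤ P k) (n : ℕ) :
    0 ≤ fejerCoeff m P n := by
  rcases eq_or_ne n 0 with rfl | hn
  · rw [fejerCoeff_zero]
  · rw [fejerCoeff, Finsupp.erase_ne hn]
    simp only [Finsupp.finsetSum_apply]
    refine Finset.sum_nonneg fun j hj => Finset.sum_nonneg fun k hk => ?_
    rw [Finset.mem_range] at hj hk
    have := hP j hj
    have := hP k hk
    rw [Finsupp.single_apply]
    split_ifs <;> positivity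

lemma toeplitzForm_eq_fejerCoeff {m : ℕ} {P : ℕ → ℝ} (hP : 0 < ∑ i ∈ Finset.range m, P i ^ 2)
    (h : ℕ → ℝ) :
    toeplitzForm m P h = (∑ i ∈ Finset.range m, P i ^ 2) *
      (h 0 + 2 * ∑ n ∈ (fejerCoeff m P).support, fejerCoeff m P n * h n) := by
  set B := ∑ i ∈ Finset.range m, P i ^ 2 with hB
  set d := ∑ j ∈ Finset.range m, ∑ k ∈ Finset.range m,
    Finsupp.single (Nat.dist j k) (P j * P k / (2 * B)) with hd
  have h1 : d.sum (fun n x => x * h n) = toeplitzForm m P h / (2 * B) := by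
    rw [hd, ← Finsupp.sum_finsetSum_index (by simp) (by intros; ring), toeplitzForm,
      Finset.sum_div]
    refine Finset.sum_congr rfl fun j _ => ?_
    rw [← Finsupp.sum_finsetSum_index (by simp) (by intros; ring), Finset.sum_div]
    refine Finset.sum_congr rfl fun k _ => ?_
    rw [Finsupp.sum_single_index (by simp)]
    ring
  have h2 : d 0 = 1 / 2 := by
    have h3 : d 0 = B / (2 * B) := by
      rw [hd]
      simp only [Finsupp.finsetSum_apply]
      conv_rhs => rw [hB, Finset.sum_div]
      refine Finset.sum_congr rfl fun j hj => ?_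
      rw [Finset.sum_eq_single j]
      · simp [sq, hB]
      · intro k _ hk
        rw [Finsupp.single_apply, if_neg]
        intro h0
        exact hk (Nat.eq_of_dist_eq_zero h0).symm
      · exact fun h => absurd hj h
    rw [h3]
    field_simp
  have h3 : d.sum (fun n x => x * h n)
      = d 0 * h 0 + ∑ n ∈ (fejerCoeff m P).support, fejerCoeff m P n * h n :=
    (Finsupp.add_sum_erase' d 0 (fun n x => x * h n) (by simp)).symm
  rw [h1, h2] at h3
  rw [div_eq_iff (by positivity)] at h3
  rw [h3]
  ring

lemma fejerCoeff_cos_nonneg {m : ℕ} {P : ℕ → ℝ} (hP : 0 < ∑ i ∈ Finset.range m, P i ^ 2)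
    (α : ℝ) : 0 ≤ 1 + ∑ n ∈ (fejerCoeff m P).support, 2 * fejerCoeff m P n * cos ((n : ℝ) * α) := by
  have h := toeplitzForm_eq_fejerCoeff hP (fun n => cos ((n : ℝ) * α))
  rw [toeplitzForm_cos, Finset.mul_sum] at h
  simp only [Nat.cast_zero, zero_mul, cos_zero, ← mul_assoc] at h
  refine (mul_nonneg_iff_of_pos_left hP).1 ?_
  rw [← h]
  positivity

lemma cos_sub_one_half_pos {m : ℕ} (hm : 2 ≤ m) {φ : ℝ}
    (hφ : φ ∈ Icc (π / ((m : ℝ) + 1)) (π / m)) : 0 < cos (((m : ℝ) - 1) * φ / 2) := by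
  have hm2 : (2 : ℝ) ≤ m := by exact_mod_cast hm
  have h0 : 0 < φ := lt_of_lt_of_le (by positivity) hφ.1
  have h1 : φ * m ≤ π := (le_div_iff₀ (by linarith)).1 hφ.2
  apply cos_pos_of_mem_Ioo
  constructor
  · nlinarith [pi_pos]
  · nlinarith

lemma Fm_nonneg {m : ℕ} (hm : 2 ≤ m) {φ : ℝ} (hφ : φ ∈ Icc (π / ((m : ℝ) + 1)) (π / m)) :
    0 ≤ Fm m φ := by
  have hm2 : (2 : ℝ) ≤ m := by exact_mod_cast hm
  have h1 : φ * m ≤ π := (le_div_iff₀ (by linarith)).1 hφ.2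
  have h2 : π ≤ φ * (m + 1) := (div_le_iff₀ (by linarith)).1 hφ.1
  refine div_nonneg (neg_nonneg.2 (cos_nonpos_of_pi_div_two_le_of_le ?_ ?_))
    (cos_sub_one_half_pos hm hφ).le
  · linarith
  · nlinarith [pi_pos]

lemma Fm_lt_one {m : ℕ} (hm : 2 ≤ m) {φ : ℝ} (hφ : φ ∈ Icc (π / ((m : ℝ) + 1)) (π / m))
    (hφ1 : φ < π / m) : Fm m φ < 1 := by
  have hm2 : (2 : ℝ) ≤ m := by exact_mod_cast hm
  have h0 : 0 < φ := lt_of_lt_of_le (by positivity) hφ.1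
  have h1 : φ * m < π := (lt_div_iff₀ (by linarith)).1 hφ1
  rw [Fm, div_lt_one (cos_sub_one_half_pos hm hφ)]
  have h2 : 0 < cos (m * φ / 2) := cos_pos_of_mem_Ioo ⟨by nlinarith [pi_pos], by linarith⟩
  have h3 : 0 < cos (φ / 2) := cos_pos_of_mem_Ioo ⟨by nlinarith [pi_pos], by nlinarith⟩
  have h4 : cos (((m : ℝ) + 1) * φ / 2) + cos (((m : ℝ) - 1) * φ / 2)
      = 2 * (cos (m * φ / 2) * cos (φ / 2)) := by
    rw [show ((m : ℝ) + 1) * φ / 2 = m * φ / 2 + φ / 2 by ring,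
      show ((m : ℝ) - 1) * φ / 2 = m * φ / 2 - φ / 2 by ring, cos_add, cos_sub]
    ring
  have h5 := mul_pos h2 h3
  linarith

lemma cos_add_Fm_mul_cos {m : ℕ} (hm : 2 ≤ m) {φ : ℝ}
    (hφ : φ ∈ Icc (π / ((m : ℝ) + 1)) (π / m)) :
    cos (((m : ℝ) + 1) * φ / 2) + Fm m φ * cos (((m : ℝ) - 1) * φ / 2) = 0 := by
  rw [Fm, div_mul_cancel₀ _ (cos_sub_one_half_pos hm hφ).ne']
  ring

/-- The value of `N - 1` corresponding to the angle `φ`. -/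
noncomputable def lamOf (m : ℕ) (r φ : ℝ) : ℝ :=
  r ^ m * (r + Fm m φ) / (1 + r * Fm m φ)

/-- Twice the total mass of the extremal measure corresponding to the angle `φ`. -/
noncomputable def massOf (m : ℕ) (r φ : ℝ) : ℝ :=
  1 - lamOf m r φ + (1 + lamOf m r φ) * (r - r⁻¹) / (r + r⁻¹ - 2 * cos φ)

lemma add_inv_sub_cos_pos {r : ℝ} (hr : 0 < r) (hr3 : 3 ≤ r ^ 2) (φ : ℝ) :
    0 < r + r⁻¹ - 2 * cos φ := by
  have := add_inv_ge hr hr3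
  have := cos_le_one φ
  linarith

lemma duality_of_lt {r φ : ℝ} {m : ℕ} (hr : 0 < r) (hr3 : 3 ≤ r ^ 2) (hm : 2 ≤ m)
    (hφ : φ ∈ Icc (π / ((m : ℝ) + 1)) (π / m)) (hφ1 : φ < π / m) :
    (∀ c : ℕ →₀ ℝ, (∀ n, 0 ≤ c n) → c 0 = 0 →
      (∀ φ : ℝ, 0 ≤ 1 + ∑ n ∈ c.support, 2 * c n * cos ((n : ℝ) * φ)) →
      ∑ n ∈ c.support, c n * (lamOf m r φ / r ^ n - r ^ n) ≤ massOf m r φ / 2) ∧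
    toeplitzForm m (quotCoeff (Fm m φ) φ)
      (fun n => if n = 0 then massOf m r φ else r ^ n - lamOf m r φ / r ^ n) = 0 := by
  obtain ⟨S, w, hS, h0, heq, hle⟩ := exists_extremal_measure hr hr3 hm (Fm_nonneg hm hφ)
    (Fm_lt_one hm hφ hφ1) hφ.1 hφ1 (cos_add_Fm_mul_cos hm hφ) (l := lamOf m r φ) rfl
    (div_mul_cancel₀ _ (add_inv_sub_cos_pos hr hr3 φ).ne')
  exact ⟨fun c hc hc0 hpos => sum_le_of_measure (fun z hz => ⟨(hS z hz).1, (hS z hz).2.1⟩) h0 hle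
    hc hc0 hpos, toeplitzForm_eq_zero_of_measure hS h0 heq⟩

lemma duality {r φ : ℝ} {m : ℕ} (hr : 0 < r) (hr3 : 3 ≤ r ^ 2) (hm : 2 ≤ m)
    (hφ : φ ∈ Icc (π / ((m : ℝ) + 1)) (π / m)) :
    (∀ c : ℕ →₀ ℝ, (∀ n, 0 ≤ c n) → c 0 = 0 →
      (∀ φ : ℝ, 0 ≤ 1 + ∑ n ∈ c.support, 2 * c n * cos ((n : ℝ) * φ)) →
      ∑ n ∈ c.support, c n * (lamOf m r φ / r ^ n - r ^ n) ≤ massOf m r φ / 2) ∧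
    toeplitzForm m (quotCoeff (Fm m φ) φ)
      (fun n => if n = 0 then massOf m r φ else r ^ n - lamOf m r φ / r ^ n) = 0 := by
  rcases hφ.2.lt_or_eq with h | h
  · exact duality_of_lt hr hr3 hm hφ h
  have hm2 : (2 : ℝ) ≤ m := by exact_mod_cast hm
  have hlt : π / ((m : ℝ) + 1) < φ := by
    rw [h]
    exact div_lt_div_of_pos_left pi_pos (by linarith) (by linarith)
  have hpos : 0 < φ := lt_of_lt_of_le (by positivity) hφ.1
  have hlpi : φ < π := by
    rw [h]
    exact div_lt_self pi_pos (by linarith)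
  have hsin : sin φ ≠ 0 := (sin_pos_of_pos_of_lt_pi hpos hlpi).ne'
  have hcos := (cos_sub_one_half_pos hm hφ).ne'
  have hF : ContinuousAt (Fm m) φ := by
    unfold Fm
    exact ContinuousAt.div (by fun_prop) (by fun_prop) hcos
  have hF0 := Fm_nonneg hm hφ
  have hden : 1 + r * Fm m φ ≠ 0 := by positivity
  have hL : ContinuousAt (lamOf m r) φ := by
    unfold lamOf
    exact ContinuousAt.div (by fun_prop) (by fun_prop) hden
  have hM : ContinuousAt (massOf m r) φ := by
    unfold massOf
    exact (by fun_prop : ContinuousAt (fun φ => 1 - lamOf m r φ) φ).add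
      (ContinuousAt.div (by fun_prop) (by fun_prop) (add_inv_sub_cos_pos hr hr3 φ).ne')
  have hQ : ∀ k, ContinuousAt (fun x => quotCoeff (Fm m x) x k) φ := by
    intro k
    unfold quotCoeff
    exact ContinuousAt.div (by fun_prop) (by fun_prop) hsin
  have hmem : ∀ᶠ x in nhdsWithin φ (Iio φ),
      x ∈ Icc (π / ((m : ℝ) + 1)) (π / m) ∧ x < π / m := by
    filter_upwards [Ico_mem_nhdsLT hlt] with x hx
    rw [← h]
    exact ⟨⟨hx.1, hx.2.le⟩, hx.2⟩
  constructor
  · intro c hc hc0 hcpos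
    have h1 : ContinuousAt
        (fun x => ∑ n ∈ c.support, c n * (lamOf m r x / r ^ n - r ^ n)) φ := by
      fun_prop
    have h2 : ContinuousAt (fun x => massOf m r x / 2) φ := by fun_prop
    refine le_of_tendsto_of_tendsto (b := nhdsWithin φ (Iio φ))
      (h1.tendsto.mono_left nhdsWithin_le_nhds) (h2.tendsto.mono_left nhdsWithin_le_nhds) ?_
    filter_upwards [hmem] with x hx
    exact (duality_of_lt hr hr3 hm hx.1 hx.2).1 c hc hc0 hcpos
  · have h1 : ContinuousAt (fun x => toeplitzForm m (quotCoeff (Fm m x) x)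
        (fun n => if n = 0 then massOf m r x else r ^ n - lamOf m r x / r ^ n)) φ := by
      have h2 : ∀ n : ℕ, ContinuousAt
          (fun x => if n = 0 then massOf m r x else r ^ n - lamOf m r x / r ^ n) φ := by
        intro n
        split_ifs <;> fun_prop
      unfold toeplitzForm
      fun_prop
    refine tendsto_nhds_unique_of_eventuallyEq (l := nhdsWithin φ (Iio φ))
      (h1.tendsto.mono_left nhdsWithin_le_nhds) tendsto_const_nhds ?_
    filter_upwards [hmem] with x hx
    exact (duality_of_lt hr hr3 hm hx.1 hx.2).2

lemma quotCoeff_nonneg {m : ℕ} (hm : 2 ≤ m) {φ u : ℝ} (hu : 0 ≤ u)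
    (hφ : φ ∈ Icc (π / ((m : ℝ) + 1)) (π / m)) {k : ℕ} (hk : k < m) :
    0 ≤ quotCoeff u φ k := by
  have hm2 : (2 : ℝ) ≤ m := by exact_mod_cast hm
  have h0 : 0 < φ := lt_of_lt_of_le (by positivity) hφ.1
  have h1 : φ * m ≤ π := (le_div_iff₀ (by linarith)).1 hφ.2
  have hk' : (k : ℝ) + 1 ≤ m := by exact_mod_cast hk
  have hs : ∀ t : ℝ, 0 ≤ t → t ≤ m → 0 ≤ sin (t * φ) := fun t ht htm =>
    sin_nonneg_of_nonneg_of_le_pi (by positivity) (by nlinarith)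
  have hs1 := hs 1 zero_le_one (by linarith)
  rw [one_mul] at hs1
  exact div_nonneg (add_nonneg (hs _ (by positivity) hk')
    (mul_nonneg hu (hs _ (by positivity) (by linarith)))) hs1

/-- The extremal problem, parametrised by the angle `φ`. -/
lemma isGreatest_massOf {r φ : ℝ} {m : ℕ} (hr : 0 < r) (hr3 : 3 ≤ r ^ 2) (hm : 2 ≤ m)
    (hφ : φ ∈ Icc (π / ((m : ℝ) + 1)) (π / m)) :
    IsGreatest
      {W : ℝ | ∃ c : ℕ →₀ ℝ, (∀ n, 0 ≤ c n) ∧ c 0 = 0 ∧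
        (∀ φ : ℝ, 0 ≤ 1 + ∑ n ∈ c.support, 2 * c n * cos ((n : ℝ) * φ)) ∧
        W = ∑ n ∈ c.support, c n * (lamOf m r φ / r ^ n - r ^ n)}
      (massOf m r φ / 2) := by
  obtain ⟨h1, h2⟩ := duality hr hr3 hm hφ
  have hm2 : (2 : ℝ) ≤ m := by exact_mod_cast hm
  have hpos : 0 < φ := lt_of_lt_of_le (by positivity) hφ.1
  have hlpi : φ < π := lt_of_le_of_lt hφ.2 (div_lt_self pi_pos (by linarith))
  have hB : 0 < ∑ i ∈ Finset.range m, quotCoeff (Fm m φ) φ i ^ 2 := by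
    refine Finset.sum_pos' (fun i _ => sq_nonneg _) ⟨0, by simp; omega, ?_⟩
    rw [quotCoeff_zero (sin_pos_of_pos_of_lt_pi hpos hlpi).ne']
    norm_num
  constructor
  · refine ⟨fejerCoeff m (quotCoeff (Fm m φ) φ),
      fejerCoeff_nonneg fun k hk => quotCoeff_nonneg hm (Fm_nonneg hm hφ) hφ hk,
      fejerCoeff_zero _ _, fejerCoeff_cos_nonneg hB, ?_⟩
    rw [toeplitzForm_eq_fejerCoeff hB] at h2
    have h3 := (mul_eq_zero.1 h2).resolve_left hB.ne'
    rw [if_pos rfl] at h3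
    have h4 : ∑ n ∈ (fejerCoeff m (quotCoeff (Fm m φ) φ)).support,
          fejerCoeff m (quotCoeff (Fm m φ) φ) n *
            (if n = 0 then massOf m r φ else r ^ n - lamOf m r φ / r ^ n)
        = -∑ n ∈ (fejerCoeff m (quotCoeff (Fm m φ) φ)).support,
          fejerCoeff m (quotCoeff (Fm m φ) φ) n * (lamOf m r φ / r ^ n - r ^ n) := by
      rw [← Finset.sum_neg_distrib]
      refine Finset.sum_congr rfl fun n hn => ?_
      have hn0 : n ≠ 0 := by
        rintro rfl
        exact (Finsupp.mem_support_iff.1 hn) (fejerCoeff_zero _ _)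
      rw [if_neg hn0]
      ring
    rw [h4] at h3
    linarith
  · rintro W ⟨c, hc, hc0, hcpos, rfl⟩
    exact h1 c hc hc0 hcpos

lemma exists_Fm_eq {m : ℕ} (hm : 2 ≤ m) {u : ℝ} (hu0 : 0 ≤ u) (hu1 : u ≤ 1) :
    ∃ φ ∈ Icc (π / ((m : ℝ) + 1)) (π / m), Fm m φ = u := by
  have hm2 : (2 : ℝ) ≤ m := by exact_mod_cast hm
  have hle : π / ((m : ℝ) + 1) ≤ π / m :=
    div_le_div_of_nonneg_left pi_pos.le (by linarith) (by linarith)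
  have hcont : ContinuousOn (Fm m) (Icc (π / ((m : ℝ) + 1)) (π / m)) := by
    unfold Fm
    exact ContinuousOn.div (by fun_prop) (by fun_prop)
      fun φ hφ => (cos_sub_one_half_pos hm hφ).ne'
  have h0 : Fm m (π / ((m : ℝ) + 1)) = 0 := by
    rw [Fm, mul_div_cancel₀ _ (by positivity), cos_pi_div_two, neg_zero, zero_div]
  have h1 : Fm m (π / m) = 1 := by
    have hc := cos_sub_one_half_pos hm (right_mem_Icc.2 hle)
    have hm0 : (m : ℝ) ≠ 0 := by positivity
    have e1 : ((m : ℝ) + 1) * (π / m) / 2 = π - ((m : ℝ) - 1) * (π / m) / 2 := by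
      field_simp
      ring
    rw [Fm, e1, cos_pi_sub, neg_neg, div_self hc.ne']
  have := intermediate_value_Icc hle hcont
  rw [h0, h1] at this
  obtain ⟨φ, hφ, h⟩ := this ⟨hu0, hu1⟩
  exact ⟨φ, hφ, h⟩

lemma rpow_half_eq_sqrt_pow {x : ℝ} (hx : 0 ≤ x) (k : ℕ) : x ^ ((k : ℝ) / 2) = √x ^ k := by
  rw [sqrt_eq_rpow, ← rpow_mul_natCast hx]
  congr 1
  ring

lemma uN_eq {q k : ℕ} (hq : 1 < q) {N : ℝ} (hN : √(q : ℝ) ^ k < N - 1) :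
    uN q (k + 1) N = (√q ^ (k + 2) - (N - 1)) / (√q * (N - 1) - √q ^ (k + 1)) := by
  have hr : 0 < √(q : ℝ) := sqrt_pos.2 (by exact_mod_cast (by omega : 0 < q))
  have e1 : (((k + 1 : ℕ) : ℝ) + 1) / 2 = ((k + 2 : ℕ) : ℝ) / 2 := by push_cast; ring
  have e2 : (((k + 1 : ℕ) : ℝ) - 1) / 2 = (k : ℝ) / 2 := by push_cast; ring
  have hd : N - 1 - √(q : ℝ) ^ k ≠ 0 := by linarith
  rw [uN, e1, e2, rpow_half_eq_sqrt_pow (Nat.cast_nonneg q),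
    rpow_half_eq_sqrt_pow (Nat.cast_nonneg q), div_sub_one hd, div_div]
  congr 1 <;> ring

/-- Let `q ≥ 3` be a prime power and `N ≥ q+1` a real number.  Over all finitely
supported sequences `(c_n)_{n ≥ 1}` of nonnegative reals with
`1 + Σ_{n≥1} 2 c_n cos (n φ) ≥ 0` for all real `φ`, the quantity
`(N−1)·Σ c_n q^{−n/2} − Σ c_n q^{n/2}` attains a maximum, equal to
`g_q(N) = 1 + (√q·θ_q(N) − 1)·N / (q − 2√q·θ_q(N) + 1)`. -/
theorem stmt_3 (q : ℕ) (hq : 3 ≤ q) (hpp : IsPrimePow q)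
    (θ : ℝ → ℝ) (hθ : IsTheta q θ) (N : ℝ) (hN : (q : ℝ) + 1 ≤ N) :
    IsGreatest
      {W : ℝ | ∃ c : ℕ →₀ ℝ, (∀ n, 0 ≤ c n) ∧ c 0 = 0 ∧
        (∀ φ : ℝ, 0 ≤ 1 + ∑ n ∈ c.support, 2 * c n * Real.cos ((n : ℝ) * φ)) ∧
        W = (N - 1) * ∑ n ∈ c.support, c n * (q : ℝ) ^ (-(n : ℝ) / 2)
              - ∑ n ∈ c.support, c n * (q : ℝ) ^ ((n : ℝ) / 2)}
      (1 + (Real.sqrt q * θ N - 1) * N / ((q : ℝ) - 2 * Real.sqrt q * θ N + 1)) := by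
  have hq0 : (0 : ℝ) ≤ q := Nat.cast_nonneg q
  have hq3 : (3 : ℝ) ≤ q := by exact_mod_cast hq
  have hpow := rpow_half_eq_sqrt_pow hq0
  have hsq : √(q : ℝ) ^ 2 = q := sq_sqrt hq0
  have huN := fun k => uN_eq (q := q) (k := k) (by omega) (N := N)
  have hr : 0 < √(q : ℝ) := sqrt_pos.2 (by linarith)
  have hθ' := hθ N hN
  generalize √(q : ℝ) = r at hpow hsq huN hr ⊢
  have hr3 : 3 ≤ r ^ 2 := by rw [hsq]; exact hq3
  have hr1 : 1 < r := by nlinarith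
  obtain ⟨m, hm0, hm1⟩ := exists_nat_pow_near (by linarith : 1 ≤ N - 1) hr1
  have hm : 2 ≤ m := by
    by_contra! h
    have : r ^ (m + 1) ≤ r ^ 2 := pow_le_pow_right₀ hr1.le (by omega)
    linarith
  have hden : 0 < r * (N - 1) - r ^ m := by nlinarith [pow_pos hr m]
  have hu : uN q m N = (r ^ (m + 1) - (N - 1)) / (r * (N - 1) - r ^ m) := by
    obtain ⟨k, rfl⟩ : ∃ k, m = k + 1 := ⟨m - 1, by omega⟩
    exact huN k (lt_of_lt_of_le (pow_lt_pow_right₀ hr1 (Nat.lt_succ_self k)) hm0)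
  have hu0 : 0 ≤ uN q m N := by
    rw [hu]
    exact div_nonneg (by linarith) hden.le
  have hu1 : uN q m N ≤ 1 := by
    rw [hu, div_le_one hden, pow_succ]
    nlinarith
  obtain ⟨φ, hφ, hFφ⟩ := exists_Fm_eq hm hu0 hu1
  have hpow1 : (q : ℝ) ^ (((m : ℝ) + 1) / 2) = r ^ (m + 1) := by
    rw [← hpow]
    push_cast
    rfl
  rw [hθ' m hm (by rwa [hpow]) (by rwa [hpow1]) φ hφ hFφ]
  have hlam : lamOf m r φ = N - 1 := by
    rw [lamOf, hFφ, div_eq_iff (by positivity)]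
    rw [eq_div_iff hden.ne'] at hu
    linear_combination -hu
  have hD := add_inv_sub_cos_pos hr hr3 φ
  have hmass : 1 + (r * cos φ - 1) * N / ((q : ℝ) - 2 * r * cos φ + 1) = massOf m r φ / 2 := by
    have hD' : r * (r + r⁻¹ - 2 * cos φ) = (q : ℝ) - 2 * r * cos φ + 1 := by
      rw [← hsq]
      field_simp
      ring
    have hne : (q : ℝ) - 2 * r * cos φ + 1 ≠ 0 := by
      rw [← hD']
      positivity
    have hsub : (1 + lamOf m r φ) * (r - r⁻¹) / (r + r⁻¹ - 2 * cos φ)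
        = N * ((q : ℝ) - 1) / ((q : ℝ) - 2 * r * cos φ + 1) := by
      rw [div_eq_div_iff hD.ne' hne, ← hD', hlam, ← hsq]
      field_simp
      ring
    rw [massOf, hsub, hlam]
    obtain ⟨D, hDq⟩ : ∃ D : ℝ, D = (q : ℝ) - 2 * r * cos φ + 1 := ⟨_, rfl⟩
    rw [← hDq] at hne ⊢
    field_simp
    linear_combination N * hDq
  rw [hmass]
  convert isGreatest_massOf hr hr3 hm hφ using 6 with W c
  have hneg : ∀ n : ℕ, (q : ℝ) ^ (-(n : ℝ) / 2) = (r ^ n)⁻¹ := by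
    intro n
    rw [neg_div, rpow_neg hq0, hpow]
  rw [Finset.mul_sum, ← Finset.sum_sub_distrib, hlam]
  simp only [hneg, hpow]
  refine and_congr_right fun _ => ?_
  have hsum : ∀ n ∈ c.support, (N - 1) * (c n * (r ^ n)⁻¹) - c n * r ^ n
      = c n * ((N - 1) / r ^ n - r ^ n) := fun n _ => by ring
  rw [Finset.sum_congr rfl hsum]
end

section
/- For every integer n ≥ 1, f^{(n)} = x^{q−1} − 1 if and only if n ≥ q. -/
open Polynomial

noncomputable section

variable (p : ℕ) [Fact p.Prime]

/-- `fN n` is the least common multiple of the minimal polynomials over `F_p` of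
`ω, ω², …, ω^{n-1}`. -/
def fN (F : Type) [Field F] [Algebra (ZMod p) F] (ω : Fˣ) (n : ℕ) : Polynomial (ZMod p) :=
  Finset.lcm (Finset.Ico 1 n) (fun i => minpoly (ZMod p) (((ω : F)) ^ i))

/-- `eN n = deg f^{(n+1)} − deg f^{(n)}`. -/
def eN (F : Type) [Field F] [Algebra (ZMod p) F] (ω : Fˣ) (n : ℕ) : ℕ :=
  (fN p F ω (n + 1)).natDegree - (fN p F ω n).natDegree

/-- A polynomial vanishing at every power of a primitive `n`-th root of unity is divisible by
`X ^ n - 1`. -/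
theorem IsPrimitiveRoot.X_pow_sub_one_dvd {K F : Type*} [Field K] [Field F] [Algebra K F]
    {ζ : F} {n : ℕ} (hζ : IsPrimitiveRoot ζ n) (hn : 0 < n) {g : K[X]}
    (hg : ∀ i < n, aeval (ζ ^ i) g = 0) : (X ^ n - 1 : K[X]) ∣ g := by
  rw [← map_dvd_map' (algebraMap K F), Polynomial.map_sub, Polynomial.map_pow, map_X,
    Polynomial.map_one, X_pow_sub_one_eq_prod hn hζ]
  refine Finset.prod_dvd_of_coprime (fun x _ y _ hxy => ?_) fun x hx => ?_
  · exact isCoprime_X_sub_C_of_isUnit_sub (sub_ne_zero.mpr hxy).isUnit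
  · rw [Polynomial.mem_nthRootsFinset hn] at hx
    have : NeZero n := ⟨hn.ne'⟩
    obtain ⟨i, hi, rfl⟩ := hζ.eq_pow_of_pow_eq_one hx
    rw [dvd_iff_isRoot, IsRoot, eval_map_algebraMap]
    exact hg i hi

/-- An algebraic element whose minimal polynomial vanishes at `1` is `1`. -/
theorem eq_one_of_aeval_one_minpoly_eq_zero {K F : Type*} [Field K] [Field F] [Algebra K F]
    {x : F} (hx : IsIntegral K x) (h : aeval (1 : F) (minpoly K x) = 0) : x = 1 := by
  have h1 := minpoly.eq_of_irreducible_of_monic (minpoly.irreducible hx) h (minpoly.monic hx)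
  have h2 := minpoly.aeval K x
  rw [h1, minpoly.one] at h2
  simpa [sub_eq_zero] using h2

/-- For every integer `n ≥ 1`, `f^{(n)} = x^{q−1} − 1` if and only if `n ≥ q`. -/
theorem stmt_5 (e : ℕ) (he : 1 ≤ e) (F : Type) [Field F] [Fintype F]
    [Algebra (ZMod p) F] (hF : Fintype.card F = p ^ e)
    (ω : Fˣ) (hω : ∀ x : Fˣ, x ∈ Subgroup.zpowers ω)
    (n : ℕ) (hn : 1 ≤ n) :
    fN p F ω n = X ^ (p ^ e - 1) - 1 ↔ p ^ e ≤ n := by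
  have hord : orderOf ω = p ^ e - 1 := by
    rw [orderOf_eq_card_of_forall_mem_zpowers hω, Nat.card_units, Nat.card_eq_fintype_card, hF]
  constructor
  · intro h
    have hdvd : fN p F ω n ∣ ∏ i ∈ Finset.Ico 1 n, minpoly (ZMod p) ((ω : F) ^ i) :=
      Finset.lcm_dvd_prod _ _
    have hroot : aeval (1 : F) (∏ i ∈ Finset.Ico 1 n, minpoly (ZMod p) ((ω : F) ^ i)) = 0 :=
      aeval_eq_zero_of_dvd_aeval_eq_zero hdvd (by simp [h])
    rw [map_prod, Finset.prod_eq_zero_iff] at hroot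
    obtain ⟨i, hi, h0⟩ := hroot
    rw [Finset.mem_Ico] at hi
    have hone : ω ^ i = 1 := Units.ext <| by
      simpa using eq_one_of_aeval_one_minpoly_eq_zero (Algebra.IsIntegral.isIntegral _) h0
    have := Nat.le_of_dvd hi.1 (orderOf_dvd_of_pow_eq_one hone)
    omega
  · intro h
    have hlt : 1 < p ^ e := Nat.one_lt_pow (by omega) (Fact.out : p.Prime).one_lt
    have hprim : IsPrimitiveRoot (ω : F) (p ^ e - 1) :=
      IsPrimitiveRoot.coe_units_iff.mpr (hord ▸ IsPrimitiveRoot.orderOf ω)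
    have hmonic : (X ^ (p ^ e - 1) - 1 : (ZMod p)[X]).Monic := by
      simpa using monic_X_pow_sub_C (1 : ZMod p) (n := p ^ e - 1) (by omega)
    refine dvd_antisymm_of_normalize_eq Finset.normalize_lcm hmonic.normalize_eq_self ?_ ?_
    · refine Finset.lcm_dvd fun i _ => minpoly.dvd _ _ ?_
      simp [pow_right_comm _ i, hprim.pow_eq_one]
    · refine hprim.X_pow_sub_one_dvd (by omega) fun i hi => ?_
      have hroot : ∀ j ∈ Finset.Ico 1 n, aeval ((ω : F) ^ j) (fN p F ω n) = 0 := fun j hj =>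
        aeval_eq_zero_of_dvd_aeval_eq_zero (Finset.dvd_lcm hj) (minpoly.aeval _ _)
      rcases Nat.eq_zero_or_pos i with rfl | hi0
      · rw [pow_zero, ← hprim.pow_eq_one]
        exact hroot _ (Finset.mem_Ico.mpr (by omega))
      · exact hroot i (Finset.mem_Ico.mpr (by omega))

end
end

section
/- For every integer n ≥ 1, f^{(n)} = 1 + x + x² + ⋯ + x^{q−2} if and only if q − q/p ≤ n < q. -/
open Polynomial

noncomputable section

variable (p : ℕ) [Fact p.Prime]

/-- An interval of length `Q` reaching up to `p * Q` meets every orbit of multiplication by `p`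
that starts below it. -/
theorem exists_le_mul_pow_lt {p Q i : ℕ} (hp : 2 ≤ p) (hi : 1 ≤ i) (hiQ : i + 1 < p * Q) :
    ∃ k, Q ≤ i * p ^ k ∧ i * p ^ k + 1 < p * Q := by
  have hex : ∃ k, Q ≤ i * p ^ k :=
    ⟨Q, (Nat.lt_pow_self (by omega)).le.trans (Nat.le_mul_of_pos_left _ hi)⟩
  classical
  refine ⟨Nat.find hex, Nat.find_spec hex, ?_⟩
  rcases hk : Nat.find hex with _ | k
  · simpa using hiQ
  · have hlt : i * p ^ k < Q := not_le.mp (Nat.find_min hex (by omega))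
    have hmul : p * (i * p ^ k + 1) ≤ p * Q := Nat.mul_le_mul_left p hlt
    have hpow : i * p ^ (k + 1) = p * (i * p ^ k) := by ring
    rw [hpow]
    linarith

section

variable {F : Type} [Field F] [Algebra (ZMod p) F] (ω : Fˣ)

theorem fN_monic [Finite F] (n : ℕ) : (fN p F ω n).Monic := by
  have h0 : fN p F ω n ≠ 0 :=
    Finset.lcm_ne_zero_iff.mpr fun i _ => minpoly.ne_zero (Algebra.IsIntegral.isIntegral _)
  have h : normalize (fN p F ω n) = fN p F ω n := Finset.normalize_lcm
  rw [← h]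
  exact monic_normalize h0

theorem exists_aeval_minpoly_eq_zero_of_aeval_fN_eq_zero {n : ℕ} {a : F}
    (h : aeval a (fN p F ω n) = 0) :
    ∃ i ∈ Finset.Ico 1 n, aeval a (minpoly (ZMod p) ((ω : F) ^ i)) = 0 := by
  have hdvd : fN p F ω n ∣ ∏ i ∈ Finset.Ico 1 n, minpoly (ZMod p) ((ω : F) ^ i) :=
    Finset.lcm_dvd fun i hi => Finset.dvd_prod_of_mem _ hi
  have hz := aeval_eq_zero_of_dvd_aeval_eq_zero hdvd h
  rwa [map_prod, Finset.prod_eq_zero_iff] at hz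

theorem aeval_fN_pow_eq_zero {n i : ℕ} (hi : i ∈ Finset.Ico 1 n) :
    aeval ((ω : F) ^ i) (fN p F ω n) = 0 :=
  aeval_eq_zero_of_dvd_aeval_eq_zero
    (Finset.dvd_lcm (f := fun i => minpoly (ZMod p) ((ω : F) ^ i)) hi) (minpoly.aeval _ _)

/-- Evaluating a polynomial over `F_p` commutes with the `p ^ k`-th power map. -/
theorem aeval_pow_char_pow (f : (ZMod p)[X]) (a : F) (k : ℕ) :
    aeval (a ^ p ^ k) f = aeval a f ^ p ^ k := by
  induction k with
  | zero => simp
  | succ k ih =>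
    rw [pow_succ, pow_mul, ← expand_aeval, ZMod.expand_card, map_pow, ih, ← pow_mul]

theorem exists_eq_pow_char_pow [Finite F] {a b : F} (h : aeval b (minpoly (ZMod p) a) = 0) :
    ∃ k : ℕ, a = b ^ p ^ k := by
  have : Normal (ZMod p) F := IsGalois.to_normal
  obtain ⟨σ, hσ⟩ := minpoly.exists_algEquiv_of_root
    (Algebra.IsAlgebraic.isAlgebraic a) h
  obtain ⟨k, hk⟩ := (FiniteField.bijective_frobeniusAlgEquivOfAlgebraic_pow (ZMod p) F).2 σ
  refine ⟨k, ?_⟩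
  rw [← hσ, ← hk]
  simp [AlgEquiv.coe_pow, FiniteField.coe_frobeniusAlgEquivOfAlgebraic_iterate, ZMod.card]

variable {p} in
theorem aeval_geom_sum_eq_zero [Fintype F] {q : ℕ} (hF : Fintype.card F = q) {a : F}
    (h0 : a ≠ 0) (h1 : a ≠ 1) :
    aeval a (∑ i ∈ Finset.range (q - 1), X ^ i : (ZMod p)[X]) = 0 := by
  have h := geom_sum_mul a (q - 1)
  rw [← hF, FiniteField.pow_card_sub_one_eq_one a h0, sub_self] at h
  rw [← hF]
  simpa [sub_ne_zero.mpr h1] using h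

variable {p} in
theorem aeval_one_geom_sum_ne_zero [Fintype F] {q : ℕ} (hF : Fintype.card F = q) :
    aeval (1 : F) (∑ i ∈ Finset.range (q - 1), X ^ i : (ZMod p)[X]) ≠ 0 := by
  have hq : 1 ≤ q := hF ▸ Fintype.card_pos
  have hz : (q : F) = 0 := hF ▸ FiniteField.cast_card_eq_zero F
  simp [Nat.cast_sub hq, hz]

variable {p} in
theorem natDegree_geom_sum_le (m : ℕ) :
    (∑ i ∈ Finset.range m, X ^ i : (ZMod p)[X]).natDegree ≤ m - 1 :=
  natDegree_sum_le_of_forall_le _ _ fun i hi => by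
    rw [natDegree_X_pow]
    have := Finset.mem_range.mp hi
    omega

variable {ω} in
theorem orderOf_coe_of_generator [Fintype F] (hω : ∀ x : Fˣ, x ∈ Subgroup.zpowers ω) :
    orderOf (ω : F) = Fintype.card F - 1 := by
  classical
  rw [orderOf_units, orderOf_eq_card_of_forall_mem_zpowers hω, Nat.card_eq_fintype_card,
    Fintype.card_units]

end

/-- For every integer `n ≥ 1`, `f^{(n)} = 1 + x + ⋯ + x^{q−2}` if and only if
`q − q/p ≤ n < q`. -/
theorem stmt_6 (e : ℕ) (he : 1 ≤ e) (F : Type) [Field F] [Fintype F]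
    [Algebra (ZMod p) F] (hF : Fintype.card F = p ^ e)
    (ω : Fˣ) (hω : ∀ x : Fˣ, x ∈ Subgroup.zpowers ω)
    (n : ℕ) (hn : 1 ≤ n) :
    fN p F ω n = ∑ i ∈ Finset.range (p ^ e - 1), X ^ i ↔
      (p ^ e - p ^ e / p ≤ n ∧ n < p ^ e) := by
  have hp : p.Prime := Fact.out
  have hp2 := hp.two_le
  obtain ⟨d, rfl⟩ : ∃ d, e = d + 1 := ⟨e - 1, by omega⟩
  have hdiv : p ^ (d + 1) / p = p ^ d := by
    rw [pow_succ, Nat.mul_div_cancel _ hp.pos]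
  rw [hdiv]
  set q := p ^ (d + 1) with hq
  have hqQ : q = p * p ^ d := by rw [hq]; ring
  have hQ : 0 < p ^ d := pow_pos hp.pos d
  have h2Q : 2 * p ^ d ≤ q := hqQ ▸ Nat.mul_le_mul_right _ hp2
  have hord : orderOf (ω : F) = q - 1 := hF ▸ orderOf_coe_of_generator hω
  have hωq : (ω : F) ^ (q - 1) = 1 := hord ▸ pow_orderOf_eq_one _
  have hne {m : ℕ} (h1 : 0 < m) (h2 : m < q - 1) : (ω : F) ^ m ≠ 1 :=
    pow_ne_one_of_lt_orderOf h1.ne' (hord ▸ h2)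
  constructor
  · intro h
    constructor
    · by_contra! hlt
      have hm := hne (m := q - 1 - p ^ d) (by omega) (by omega)
      have hroot := aeval_geom_sum_eq_zero (p := p) hF (pow_ne_zero _ ω.ne_zero) hm
      rw [← h] at hroot
      obtain ⟨i, hi, hi0⟩ := exists_aeval_minpoly_eq_zero_of_aeval_fN_eq_zero p ω hroot
      rw [Finset.mem_Ico] at hi
      obtain ⟨k, hk⟩ := exists_eq_pow_char_pow p hi0
      have hone : (ω : F) ^ i * (ω : F) ^ (p ^ (d + k)) = 1 := by
        rw [hk, pow_add p, pow_mul, ← mul_pow, ← pow_add, Nat.sub_add_cancel (by omega), hωq,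
          one_pow]
      have hred : (ω : F) ^ (p ^ (d + k)) = (ω : F) ^ (p ^ ((d + k) % (d + 1))) := by
        conv_lhs => rw [← Nat.mod_add_div (d + k) (d + 1)]
        rw [pow_add p, pow_mul, pow_mul p (d + 1), ← hq, ← hF, FiniteField.pow_card_pow]
      rw [hred, ← pow_add] at hone
      have hle : p ^ ((d + k) % (d + 1)) ≤ p ^ d :=
        Nat.pow_le_pow_right hp.pos (Nat.lt_succ_iff.mp (Nat.mod_lt _ d.succ_pos))
      exact hne (by omega) (by omega) hone
    · by_contra! hle
      refine aeval_one_geom_sum_ne_zero (p := p) hF ?_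
      rw [← h, ← hωq]
      exact aeval_fN_pow_eq_zero p ω (Finset.mem_Ico.mpr (by omega))
  · rintro ⟨hlow, hup⟩
    have hdvd : fN p F ω n ∣ ∑ i ∈ Finset.range (q - 1), X ^ i :=
      Finset.lcm_dvd fun i hi => minpoly.dvd _ _ <| by
        rw [Finset.mem_Ico] at hi
        exact aeval_geom_sum_eq_zero hF (pow_ne_zero _ ω.ne_zero) (hne (by omega) (by omega))
    have hroot (a : F) (h0 : a ≠ 0) (h1 : a ≠ 1) : aeval a (fN p F ω n) = 0 := by
      classical
      have hfin : IsOfFinOrder ω := isOfFinOrder_of_finite ω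
      obtain ⟨j, hj, hja⟩ := (hfin.mem_zpowers_iff_mem_range_orderOf.mp
        (hω (Units.mk0 a h0)⁻¹) |> Finset.mem_image.mp)
      rw [Finset.mem_range, ← orderOf_units, hord] at hj
      have hj0 : 1 ≤ j := by
        rw [Nat.one_le_iff_ne_zero]
        rintro rfl
        exact h1 (by simpa [Units.ext_iff, eq_comm] using hja)
      have hja' : (ω : F) ^ j * a = 1 := by
        have := congrArg Units.val hja
        rw [Units.val_pow_eq_pow_val] at this
        rw [this]
        simp [h0]
      obtain ⟨k, hk1, hk2⟩ := exists_le_mul_pow_lt (Q := p ^ d) hp2 hj0 (by omega)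
      rw [← hqQ] at hk2
      have hinv : (ω : F) ^ (j * p ^ k) * a ^ p ^ k = 1 := by
        rw [pow_mul, ← mul_pow, hja', one_pow]
      have ha : a ^ p ^ k = (ω : F) ^ (q - 1 - j * p ^ k) := by
        refine mul_left_cancel₀ (pow_ne_zero (j * p ^ k) ω.ne_zero) ?_
        rw [hinv, ← pow_add, Nat.add_sub_cancel' (by omega), hωq]
      have hz := aeval_fN_pow_eq_zero p ω (n := n) (i := q - 1 - j * p ^ k)
        (Finset.mem_Ico.mpr (by omega))
      rw [← ha, aeval_pow_char_pow] at hz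
      exact eq_zero_of_pow_eq_zero hz
    have hmonic := fN_monic p ω n
    have hdeg : q - 2 ≤ (fN p F ω n).natDegree := by
      classical
      have hcard := card_le_degree_of_subset_roots
        (p := (fN p F ω n).map (algebraMap (ZMod p) F)) (Z := ({0, 1} : Finset F)ᶜ) <| by
          intro a ha
          have ha' : a ≠ 0 ∧ a ≠ 1 := by
            rw [Finset.mem_val, Finset.mem_compl] at ha
            simpa using ha
          rw [mem_roots (hmonic.map _).ne_zero, IsRoot.def, eval_map_algebraMap]
          exact hroot a ha'.1 ha'.2
      rwa [Finset.card_compl, hF, Finset.card_pair zero_ne_one, natDegree_map] at hcard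
    refine (eq_of_monic_of_dvd_of_natDegree_le hmonic (monic_geom_sum_X (by omega)) hdvd ?_).symm
    exact (natDegree_geom_sum_le _).trans (by omega)

end
end

section
/- Suppose e is even and set r := p^{e/2} (so r = √q). Then e^{(n)} = e for every n ∈ {1,…,2r} with p ∤ n and n ≠ r+1; moreover e^{(r+1)} = e/2 and e^{(2r+1)} = 0. -/
open Polynomial

noncomputable section

variable (p : ℕ) [Fact p.Prime]

/-- A residue `n ≤ 2 * p ^ m` prime to `p` is minimal in its `p`-cyclotomic coset modulo
`p ^ (2 * m) - 1`, and no smaller power of `p` than `p ^ (2 * m)` fixes it, except for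
`n = p ^ m + 1`, which is fixed by `p ^ m`. -/
theorem eq_of_mul_pow_modEq {m r i n k : ℕ} (hr : r = p ^ m) (hm : 1 ≤ m) (hi : 1 ≤ i)
    (hin : i ≤ n) (hn : n ≤ 2 * r) (hpn : ¬ p ∣ n) (hk : 0 < k) (hk2 : k < 2 * m)
    (h : i * p ^ k ≡ n [MOD r ^ 2 - 1]) : i = r + 1 ∧ n = r + 1 ∧ k = m := by
  have hp : p.Prime := Fact.out
  have hp2 := hp.two_le
  have hpr : p ∣ r := hr ▸ dvd_pow_self p (by omega)
  have hr2 : 2 ≤ r := hp2.trans (Nat.le_of_dvd (hr ▸ pow_pos hp.pos _) hpr)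
  have hn' : n < 2 * r := lt_of_le_of_ne hn (fun h => hpn (h ▸ hpr.mul_left 2))
  have half : ∀ j, j < m → 2 * p ^ j ≤ r := by
    intro j hj
    calc 2 * p ^ j ≤ p * p ^ j := Nat.mul_le_mul_right _ hp2
      _ = p ^ (j + 1) := by ring
      _ ≤ r := hr ▸ Nat.pow_le_pow_right hp.pos hj
  have one_lt : ∀ j, 0 < j → 2 ≤ p ^ j := fun j hj =>
    hp2.trans (Nat.le_self_pow (by omega) p)
  have hq : ((r ^ 2 - 1 : ℕ) : ℤ) = (r : ℤ) ^ 2 - 1 := by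
    rw [Nat.cast_sub (Nat.one_le_pow _ _ (by omega))]; push_cast; ring
  rcases le_or_gt k m with hkm | hkm
  · obtain ⟨t, ht⟩ := h.symm.dvd
    rw [hq] at ht
    push_cast at ht
    have hkr : p ^ k ≤ r := hr ▸ Nat.pow_le_pow_right hp.pos hkm
    have h1 := one_lt k hk
    have hle : i * p ^ k ≤ n * r := Nat.mul_le_mul hin hkr
    have hpk : p ∣ p ^ k := dvd_pow_self p (by omega)
    have ht0 : 0 ≤ t := by
      by_contra hc
      have : t ≤ -1 := by omega
      zify at *
      nlinarith [mul_pos (by linarith : (0:ℤ) < i) (by linarith : (0:ℤ) < (p:ℤ)^k), sq_nonneg ((r:ℤ) - 1)]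
    have ht2 : t < 2 := by
      by_contra hc
      have : 2 ≤ t := by omega
      zify at *
      nlinarith
    obtain rfl | rfl : t = 0 ∨ t = 1 := by omega
    · exfalso
      have : i * p ^ k = n := by zify; linarith
      exact hpn (this ▸ hpk.mul_left i)
    · have e1 : (i : ℤ) * p ^ k = r ^ 2 - 1 + n := by linarith
      rcases hkm.lt_or_eq with hlt | rfl
      · exfalso
        have h2 := half k hlt
        zify at *
        nlinarith [mul_le_mul_of_nonneg_right hin (by linarith : (0:ℤ) ≤ (p:ℤ)^k), mul_le_mul_of_nonneg_left h2 (by linarith : (0:ℤ) ≤ n)]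
      · have e2 : ((p : ℤ) ^ k) = r := by rw [hr]; push_cast; rfl
        rw [e2] at e1
        have e3 : (n : ℤ) - 1 = r * (i - r) := by linarith
        have hc : (i : ℤ) - r = 1 := by
          have a : 0 ≤ (i : ℤ) - r := by
            by_contra hc
            have : (i : ℤ) - r ≤ -1 := by omega
            zify at *
            nlinarith
          have b : (i : ℤ) - r < 2 := by
            by_contra hc
            have : 2 ≤ (i : ℤ) - r := by omega
            zify at *
            nlinarith
          have c : (i : ℤ) - r ≠ 0 := by
            intro h0
            rw [h0] at e3
            omega
          omega
        rw [hc] at e3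
        refine ⟨by omega, by omega, rfl⟩
  · exfalso
    have h1 := one_lt (2 * m - k) (by omega)
    have h2 := half (2 * m - k) (by omega)
    have h3 : i ≡ n * p ^ (2 * m - k) [MOD r ^ 2 - 1] := by
      have e1 := h.mul_right (p ^ (2 * m - k))
      rw [mul_assoc, ← pow_add, Nat.add_sub_cancel' hk2.le] at e1
      have e2 : p ^ (2 * m) ≡ 1 [MOD r ^ 2 - 1] := by
        rw [hr, ← pow_mul, mul_comm m 2]
        exact ((Nat.modEq_iff_dvd' (Nat.one_le_pow _ _ hp.pos)).2 dvd_rfl).symm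
      simpa using (e2.mul_left i).symm.trans e1
    obtain ⟨t, ht⟩ := h3.dvd
    rw [hq] at ht
    push_cast at ht
    generalize hP : p ^ (2 * m - k) = P at *
    have hP' : (p : ℤ) ^ (2 * m - k) = P := by rw [← hP]; push_cast; rfl
    rw [hP'] at ht
    zify at *
    have ht0 : 0 < t := by
      by_contra hc
      have : t ≤ 0 := by omega
      nlinarith
    have : 1 ≤ t := by omega
    nlinarith

theorem aeval_minpoly_eq_zero_iff {e : ℕ} {F : Type} [Field F] [Fintype F]
    [Algebra (ZMod p) F] (hF : Fintype.card F = p ^ e) (a b : F) :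
    aeval b (minpoly (ZMod p) a) = 0 ↔ ∃ k < e, a ^ p ^ k = b := by
  have hfin : Module.finrank (ZMod p) F = e := by
    have h := Module.card_eq_pow_finrank (K := ZMod p) (V := F)
    rw [hF, ZMod.card] at h
    exact (Nat.pow_right_injective (Fact.out : p.Prime).two_le h).symm
  have hfrob (n : ℕ) (x : F) :
      (FiniteField.frobeniusAlgEquivOfAlgebraic (ZMod p) F ^ n) x = x ^ p ^ n := by
    rw [AlgEquiv.coe_pow, FiniteField.coe_frobeniusAlgEquivOfAlgebraic_iterate, ZMod.card]
  rw [← isConjRoot_iff_aeval_eq_zero (Algebra.IsIntegral.isIntegral a), IsConjRoot.comm,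
    isConjRoot_iff_exists_algEquiv]
  constructor
  · rintro ⟨σ, rfl⟩
    obtain ⟨k, rfl⟩ :=
      (FiniteField.bijective_frobeniusAlgEquivOfAlgebraic_pow (ZMod p) F).surjective σ
    exact ⟨k, hfin ▸ k.2, (hfrob k a).symm⟩
  · rintro ⟨k, -, rfl⟩
    exact ⟨_, hfrob k a⟩

theorem pow_card_pow_sub_eq_self {F : Type} [Field F] [Algebra (ZMod p) F] {a : F} {j k : ℕ}
    (hjk : j ≤ k) (h : a ^ p ^ j = a ^ p ^ k) : a ^ p ^ (k - j) = a := by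
  have : CharP F p := charP_of_injective_algebraMap (algebraMap (ZMod p) F).injective p
  refine iterateFrobenius_inj F p j ?_
  rw [iterateFrobenius_def, iterateFrobenius_def, ← pow_mul, ← pow_add, Nat.sub_add_cancel hjk, h]

/-- If `d` is the first positive exponent (up to `e`) with `a ^ p ^ d = a`, then the minimal
polynomial of `a` has degree `d`. -/
theorem natDegree_minpoly_eq {e : ℕ} {F : Type} [Field F] [Fintype F]
    [Algebra (ZMod p) F] (hF : Fintype.card F = p ^ e) {a : F} {d : ℕ} (hd : 0 < d)
    (hde : d ≤ e) (had : a ^ p ^ d = a) (hmin : ∀ k, 0 < k → k < d → a ^ p ^ k ≠ a) :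
    (minpoly (ZMod p) a).natDegree = d := by
  classical
  have hint : IsIntegral (ZMod p) a := Algebra.IsIntegral.isIntegral a
  have hmod (k : ℕ) : a ^ p ^ k = a ^ p ^ (k % d) := by
    induction k using Nat.strong_induction_on with
    | _ k ih =>
      rcases lt_or_ge k d with h | h
      · rw [Nat.mod_eq_of_lt h]
      · rw [Nat.mod_eq_sub_mod h, ← ih (k - d) (by omega)]
        nth_rw 2 [← had]
        rw [← pow_mul, ← pow_add, Nat.add_sub_cancel' h]
  have hroots : (minpoly (ZMod p) a).rootSet F =
      ((Finset.range d).image fun k => a ^ p ^ k : Finset F) := by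
    ext b
    rw [mem_rootSet_of_ne (minpoly.ne_zero hint), aeval_minpoly_eq_zero_iff p hF]
    simp only [Finset.coe_image, Finset.coe_range, Set.mem_image, Set.mem_Iio]
    constructor
    · rintro ⟨k, -, rfl⟩
      exact ⟨k % d, Nat.mod_lt _ hd, (hmod k).symm⟩
    · rintro ⟨k, hk, rfl⟩
      exact ⟨k, hk.trans_le hde, rfl⟩
  have hinj : Set.InjOn (fun k => a ^ p ^ k) (Finset.range d : Finset ℕ) := by
    have key (j k : ℕ) (hk : k < d) (h : a ^ p ^ j = a ^ p ^ k) : k ≤ j := by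
      by_contra! hlt
      exact hmin (k - j) (by omega) (by omega) (pow_card_pow_sub_eq_self p hlt.le h)
    intro j hj k hk h
    simp only [Finset.coe_range, Set.mem_Iio] at hj hk
    exact le_antisymm (key k j hj h.symm) (key j k hk h)
  rw [← card_rootSet_eq_natDegree (K := F) (Algebra.IsSeparable.isSeparable (ZMod p) a)
    (Normal.splits inferInstance a), ← Nat.card_eq_fintype_card, hroots,
    Nat.card_coe_set_eq, Set.ncard_coe_finset, Finset.card_image_of_injOn hinj, Finset.card_range]

theorem fN_succ {F : Type} [Field F] [Algebra (ZMod p) F] (ω : Fˣ) {n : ℕ} (hn : 1 ≤ n) :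
    fN p F ω (n + 1) = lcm (minpoly (ZMod p) ((ω : F) ^ n)) (fN p F ω n) := by
  classical
  rw [fN, fN, ← Finset.insert_Ico_right_eq_Ico_add_one hn, Finset.lcm_insert]

theorem natDegree_lcm_of_isCoprime {K : Type*} [Field K] [NormalizedGCDMonoid K[X]] {f g : K[X]}
    (hf : f ≠ 0) (hg : g ≠ 0) (h : IsCoprime f g) :
    (lcm f g).natDegree = f.natDegree + g.natDegree := by
  have hgcd : IsUnit (gcd f g) := h.isUnit_of_dvd' (gcd_dvd_left f g) (gcd_dvd_right f g)
  rw [← natDegree_mul hf hg, ← natDegree_eq_of_degree_eq (degree_eq_degree_of_associated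
    ((gcd_mul_lcm f g).symm.trans (associated_unit_mul_left _ _ hgcd)))]

theorem eN_eq_natDegree_minpoly {e : ℕ} {F : Type} [Field F] [Fintype F]
    [Algebra (ZMod p) F] (hF : Fintype.card F = p ^ e) (ω : Fˣ) {n : ℕ} (hn : 1 ≤ n)
    (h : ∀ i, 1 ≤ i → i < n → ∀ k < e, ((ω : F) ^ i) ^ p ^ k ≠ (ω : F) ^ n) :
    eN p F ω n = (minpoly (ZMod p) ((ω : F) ^ n)).natDegree := by
  have hint (x : F) : IsIntegral (ZMod p) x := Algebra.IsIntegral.isIntegral x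
  have hne : fN p F ω n ≠ 0 := by
    rw [fN, Ne, Finset.lcm_eq_zero_iff]
    rintro ⟨i, -, hi⟩
    exact minpoly.ne_zero (hint _) hi
  have hcop : IsCoprime (minpoly (ZMod p) ((ω : F) ^ n)) (fN p F ω n) := by
    rw [(minpoly.irreducible (hint _)).coprime_iff_not_dvd]
    intro hdvd
    have hprod : fN p F ω n ∣ ∏ i ∈ Finset.Ico 1 n, minpoly (ZMod p) ((ω : F) ^ i) :=
      Finset.lcm_dvd fun i hi => Finset.dvd_prod_of_mem _ hi
    obtain ⟨i, hi, hdi⟩ :=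
      (minpoly.prime (hint _)).exists_mem_finset_dvd (hdvd.trans hprod)
    rw [Finset.mem_Ico] at hi
    obtain ⟨k, hk, hik⟩ := (aeval_minpoly_eq_zero_iff p hF _ _).1
      (aeval_eq_zero_of_dvd_aeval_eq_zero hdi (minpoly.aeval _ _))
    exact h i hi.1 hi.2 k hk hik
  rw [eN, fN_succ p ω hn, natDegree_lcm_of_isCoprime (minpoly.ne_zero (hint _)) hne hcop,
    Nat.add_sub_cancel]

/-- Suppose `e` is even, `r = p^{e/2} = √q`.  Then `e^{(n)} = e` for every
`n ∈ {1,…,2r}` with `p ∤ n` and `n ≠ r+1`; moreover `e^{(r+1)} = e/2` and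
`e^{(2r+1)} = 0`. -/
theorem stmt_7 (e : ℕ) (he : 1 ≤ e) (heven : 2 ∣ e) (F : Type) [Field F] [Fintype F]
    [Algebra (ZMod p) F] (hF : Fintype.card F = p ^ e)
    (ω : Fˣ) (hω : ∀ x : Fˣ, x ∈ Subgroup.zpowers ω) :
    (∀ n, 1 ≤ n → n ≤ 2 * p ^ (e / 2) → ¬ p ∣ n → n ≠ p ^ (e / 2) + 1 →
      eN p F ω n = e) ∧
    eN p F ω (p ^ (e / 2) + 1) = e / 2 ∧
    eN p F ω (2 * p ^ (e / 2) + 1) = 0 := by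
  obtain ⟨m, rfl⟩ := heven
  rw [Nat.mul_div_cancel_left m two_pos]
  have hm : 1 ≤ m := by omega
  have hp : p.Prime := Fact.out
  obtain ⟨r, hr⟩ : ∃ r, r = p ^ m := ⟨_, rfl⟩
  rw [← hr]
  have hpr : p ∣ r := hr ▸ dvd_pow_self p (by omega)
  have hr2 : 2 ≤ r := hp.two_le.trans (Nat.le_of_dvd (hr ▸ pow_pos hp.pos _) hpr)
  have hcard : p ^ (2 * m) = r ^ 2 := by rw [hr, ← pow_mul, mul_comm]
  have hpow (i j : ℕ) : (ω : F) ^ i = (ω : F) ^ j ↔ i ≡ j [MOD r ^ 2 - 1] := by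
    rw [← Units.val_pow_eq_pow_val, ← Units.val_pow_eq_pow_val, Units.val_inj,
      pow_eq_pow_iff_modEq, orderOf_eq_card_of_forall_mem_zpowers hω, Nat.card_units,
      Nat.card_eq_fintype_card, hF, hcard]
  have hconj {i n k : ℕ} (hi : 1 ≤ i) (hin : i ≤ n) (hn : n ≤ 2 * r) (hpn : ¬ p ∣ n)
      (hk : 0 < k) (hk2 : k < 2 * m) (h : ((ω : F) ^ i) ^ p ^ k = (ω : F) ^ n) :
      i = r + 1 ∧ n = r + 1 ∧ k = m := by
    rw [← pow_mul, hpow] at h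
    exact eq_of_mul_pow_modEq p hr hm hi hin hn hpn hk hk2 h
  have hnew {n : ℕ} (hn1 : 1 ≤ n) (hn : n ≤ 2 * r) (hpn : ¬ p ∣ n) :
      eN p F ω n = (minpoly (ZMod p) ((ω : F) ^ n)).natDegree := by
    refine eN_eq_natDegree_minpoly p hF ω hn1 fun i hi hin k hk h => ?_
    rcases Nat.eq_zero_or_pos k with rfl | hk0
    · rw [pow_zero, pow_one, hpow] at h
      have hdvd := Nat.le_of_dvd (by omega) ((Nat.modEq_iff_dvd' hin.le).1 h)
      have hn' : n ≠ 2 * r := fun h => hpn (h ▸ hpr.mul_left 2)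
      have hsq : 2 * r ≤ r ^ 2 := by nlinarith
      omega
    · have := hconj hi hin.le hn hpn hk0 hk h
      omega
  have hpr1 : ¬ p ∣ r + 1 := fun h => hp.one_lt.ne' (Nat.dvd_one.1 ((Nat.dvd_add_right hpr).1 h))
  refine ⟨fun n hn1 hn hpn hne => ?_, ?_, ?_⟩
  · rw [hnew hn1 hn hpn]
    refine natDegree_minpoly_eq p hF (by omega) le_rfl ?_ fun k hk hk2 h => ?_
    · rw [← hF, FiniteField.pow_card]
    · exact hne (hconj hn1 le_rfl hn hpn hk hk2 h).2.1
  · rw [hnew (by omega) (by omega) hpr1]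
    refine natDegree_minpoly_eq p hF hm (by omega) ?_ fun k hk hkm h => ?_
    · rw [← pow_mul, ← hr, hpow]
      refine ((Nat.modEq_iff_dvd' (by nlinarith)).2 ⟨1, ?_⟩).symm
      have : (r + 1) * r = r ^ 2 + r := by ring
      omega
    · have := hconj (by omega) le_rfl (by omega) hpr1 hk (by omega) h
      omega
  · have hroot : aeval ((ω : F) ^ (2 * r + 1)) (minpoly (ZMod p) ((ω : F) ^ (r + 2))) = 0 := by
      refine (aeval_minpoly_eq_zero_iff p hF _ _).2 ⟨m, by omega, ?_⟩
      rw [← pow_mul, ← hr, hpow]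
      refine ((Nat.modEq_iff_dvd' (by nlinarith)).2 ⟨1, ?_⟩).symm
      have : (r + 2) * r = r ^ 2 + 2 * r := by ring
      omega
    have hdvd : minpoly (ZMod p) ((ω : F) ^ (2 * r + 1)) ∣ fN p F ω (2 * r + 1) := by
      have hmem : r + 2 ∈ Finset.Ico 1 (2 * r + 1) := Finset.mem_Ico.2 ⟨by omega, by omega⟩
      refine dvd_trans ?_ (Finset.dvd_lcm hmem)
      exact minpoly.dvd _ _ hroot
    have hassoc : Associated (fN p F ω (2 * r + 1 + 1)) (fN p F ω (2 * r + 1)) := by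
      rw [fN_succ p ω (by omega)]
      exact associated_of_dvd_dvd (lcm_dvd hdvd dvd_rfl) (dvd_lcm_right _ _)
    rw [eN, natDegree_eq_of_degree_eq (degree_eq_degree_of_associated hassoc), Nat.sub_self]

end
end
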